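/- arXiv:1409.2308 — 7 statements merged into one kernel-verified Lean document; each statement's English description precedes it below -/
import Mathlib

section
/- (Krasner–Kaloujnine) Let N, E, G be groups and suppose 1 → N → E → G → 1 is a short exact sequence, i.e., there are an injective group homomorphism ι : N → E and a surjective group homomorphism π : E → G with ker π equal to the image of ι. Then there exists an injective group homomorphism from E into the wreath product N ≀ G. -/
/-- The wreath product `M ≀ N` of groups: underlying set `(N → M) × N` with
multiplication `(f, n)·(f', n') = (x ↦ f x · f' (x·n), n·n')`. -/
def WreathProduct (M N : Type) [Group M] [Group N] : Type := (N → M) × N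

instance WreathProduct.instGroup (M N : Type) [Group M] [Group N] :
    Group (WreathProduct M N) where
  mul p q := (fun x => p.1 x * q.1 (x * p.2), p.2 * q.2)
  one := (fun _ => 1, 1)
  inv p := (fun x => (p.1 (x * p.2⁻¹))⁻¹, p.2⁻¹)
  mul_assoc p q r := by
    refine Prod.ext ?_ (mul_assoc _ _ _)
    funext x
    show (p.1 x * q.1 (x * p.2)) * r.1 (x * (p.2 * q.2))
        = p.1 x * (q.1 (x * p.2) * r.1 ((x * p.2) * q.2))
    rw [← mul_assoc x p.2 q.2, mul_assoc]
  one_mul p := by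
    refine Prod.ext ?_ (one_mul _)
    funext x
    show (1 : M) * p.1 (x * 1) = p.1 x
    rw [one_mul, mul_one]
  mul_one p := by
    refine Prod.ext ?_ (mul_one _)
    funext x
    show p.1 x * 1 = p.1 x
    rw [mul_one]
  inv_mul_cancel p := by
    refine Prod.ext ?_ (inv_mul_cancel _)
    funext x
    show (p.1 (x * p.2⁻¹))⁻¹ * p.1 (x * p.2⁻¹) = 1
    exact inv_mul_cancel _

/-- Krasner–Kaloujnine: if `1 → N → E → G → 1` is a short exact sequence of
groups then `E` embeds into the wreath product `N ≀ G`. -/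
theorem krasner_kaloujnine
    {N E G : Type} [Group N] [Group E] [Group G]
    (ι : N →* E) (π : E →* G)
    (hι : Function.Injective ι) (hπ : Function.Surjective π)
    (hexact : MonoidHom.ker π = MonoidHom.range ι) :
    ∃ φ : E →* WreathProduct N G, Function.Injective φ := by
  choose s hs using hπ
  have hmem (e : E) (x : G) : ∃ n : N, ι n = s x * e * (s (x * π e))⁻¹ := by
    rw [← MonoidHom.mem_range, ← hexact, MonoidHom.mem_ker]
    simp [hs]
  choose c hc using hmem
  refine ⟨MonoidHom.mk' (fun e => (fun x => c e x, π e)) fun a b => ?_, fun a b h => ?_⟩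
  · refine Prod.ext (funext fun x => hι ?_) (map_mul π a b)
    change ι (c (a * b) x) = ι (c a x * c b (x * π a))
    simp only [map_mul, hc, mul_assoc, inv_mul_cancel_left]
  · have hc_eq : c a 1 = c b 1 := congrFun (congrArg Prod.fst h) 1
    have hπ_eq : π a = π b := congrArg Prod.snd h
    have key := congrArg ι hc_eq
    rw [hc, hc, hπ_eq] at key
    exact mul_left_cancel (mul_right_cancel key)
end

section
/- (Ribes–Zalesskii) Let F be a free group of finite rank, let H₁, …, Hₙ be finitely generated subgroups of F, and let g ∈ F be an element not belonging to the setwise product H₁H₂⋯Hₙ = {h₁h₂⋯hₙ | hᵢ ∈ Hᵢ}. Then there exist a finite group Q and a group homomorphism φ : F → Q such that φ(g) ∉ φ(H₁)φ(H₂)⋯φ(Hₙ). Equivalently, the product of finitely many finitely generated subgroups of a finitely generated free group is closed in the profinite topology. -/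
/-- A bundled group. -/
structure BGrp where
  carrier : Type
  [grp : Group carrier]

attribute [instance] BGrp.grp

/-- The setwise (ordered) product `A 0 · A 1 ⋯ A (n-1)` of a family of subsets of a group. -/
def setwiseProd {Q : Type} [Group Q] {n : ℕ} (A : Fin n → Set Q) : Set Q :=
  {x | ∃ a : Fin n → Q, (∀ i, a i ∈ A i) ∧ x = (List.ofFn a).prod}

namespace FreeGroup

open scoped Pointwise

variable {α Ω : Type*}

section Edges

variable [MulAction (FreeGroup α) Ω]

/-- The edge `(z, a)`, going from `z` to `a • z`, that is traversed (in either direction) when the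
letter `c` is applied to the point `x`. -/
def letterEdge (c : α × Bool) (x : Ω) : Ω × α :=
  if c.2 then (x, c.1) else ((of c.1)⁻¹ • x, c.1)

/-- The edges of the Schreier graph of `Ω` traversed by the path that starts at `x` and reads the
word `w` from right to left. -/
def edges : List (α × Bool) → Ω → List (Ω × α)
  | [], _ => []
  | c :: w, x => letterEdge c (mk w • x) :: edges w x

theorem mk_cons (c : α × Bool) (w : List (α × Bool)) : mk (c :: w) = mk [c] * mk w := by
  simp [mul_mk]

theorem mk_true (a : α) : mk [(a, true)] = of a := rfl

theorem mk_false (a : α) : mk [(a, false)] = (of a)⁻¹ := rfl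

theorem mk_nil : mk ([] : List (α × Bool)) = 1 := rfl

theorem edges_append (w₁ w₂ : List (α × Bool)) (x : Ω) :
    edges (w₁ ++ w₂) x = edges w₁ (mk w₂ • x) ++ edges w₂ x := by
  induction w₁ with
  | nil => rfl
  | cons c w ih => simp [edges, ih, ← mul_mk, mul_smul]

/-- The endpoints of an edge traversed by a path are visited by the path. -/
theorem exists_suffix_of_mem_edges {w : List (α × Bool)} {x : Ω} {e : Ω × α}
    (he : e ∈ edges w x) :
    (∃ t s, w = t ++ s ∧ e.1 = mk s • x) ∧ ∃ t s, w = t ++ s ∧ of e.2 • e.1 = mk s • x := by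
  induction w with
  | nil => simp [edges] at he
  | cons c w ih =>
    rcases List.mem_cons.1 he with rfl | he
    · obtain ⟨a, b⟩ := c
      cases b
      · exact ⟨⟨[], _, rfl, by simp [letterEdge, mk_cons (a, false) w, mk_false, mul_smul]⟩,
          [(a, false)], w, rfl, by simp [letterEdge]⟩
      · exact ⟨⟨[(a, true)], w, rfl, by simp [letterEdge]⟩,
          [], _, rfl, by simp [letterEdge, mk_cons (a, true) w, mk_true, mul_smul]⟩
    · obtain ⟨⟨t, s, rfl, h⟩, t', s', h', h''⟩ := ih he
      exact ⟨⟨c :: t, s, rfl, h⟩, c :: t', s', by simp [h'], h''⟩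

theorem even_countP_of_even_count {β : Type*} [DecidableEq β] (p : β → Prop) [DecidablePred p]
    (l : List β) (h : ∀ b, p b → Even (l.count b)) : Even (l.countP (fun b => decide (p b))) := by
  rw [List.countP_eq_length_filter, ← List.sum_toFinset_count_eq_length]
  refine Finset.even_sum _ fun b hb => ?_
  have hb' : p b := by simpa using (List.mem_filter.1 (List.mem_toFinset.1 hb)).2
  rw [List.count_filter (by simpa using hb')]
  exact h b hb'

open Classical in
/-- If no edge traversed an odd number of times by a path crosses the boundary of `C`, then the
endpoints of the path are on the same side of `C`. -/
theorem mem_iff_smul_mem_of_odd (C : Set Ω) (w : List (α × Bool)) (x : Ω)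
    (h : ∀ e : Ω × α, Odd ((edges w x).count e) → (e.1 ∈ C ↔ of e.2 • e.1 ∈ C)) :
    x ∈ C ↔ mk w • x ∈ C := by
  have key : ∀ w : List (α × Bool),
      (Even ((edges w x).countP fun e => decide ¬(e.1 ∈ C ↔ of e.2 • e.1 ∈ C)) ↔
        (x ∈ C ↔ mk w • x ∈ C)) := by
    intro w
    induction w with
    | nil => simp [edges, mk_nil]
    | cons c w ih =>
      rw [edges, List.countP_cons, mk_cons, mul_smul]
      obtain ⟨a, b⟩ := c
      cases b
      · simp only [letterEdge, mk_false, smul_inv_smul, Bool.false_eq_true, if_false]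
        split_ifs with hc <;> simp only [decide_eq_true_eq] at hc <;>
          simp only [Nat.even_add_one, add_zero, ih] <;> tauto
      · simp only [letterEdge, mk_true, if_true]
        split_ifs with hc <;> simp only [decide_eq_true_eq] at hc <;>
          simp only [Nat.even_add_one, add_zero, ih] <;> tauto
  refine (key w).1 (even_countP_of_even_count _ _ fun e he => ?_)
  by_contra hodd
  exact he (h e (by convert Nat.not_even_iff_odd.1 hodd))

open Classical in
/-- The action of a generator on pairs consisting of a point of `Ω` and a mod `2` chain of
edges. -/
noncomputable def chainPerm (Ω : Type*) [MulAction (FreeGroup α) Ω] (a : α) :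
    Equiv.Perm (Ω × (Ω × α → ZMod 2)) where
  toFun y := (of a • y.1, y.2 + Pi.single (y.1, a) 1)
  invFun y := ((of a)⁻¹ • y.1, y.2 + Pi.single ((of a)⁻¹ • y.1, a) 1)
  left_inv y := by
    ext1
    · simp
    · simp [add_assoc, ← Pi.single_add, CharTwo.add_self_eq_zero]
  right_inv y := by
    ext1
    · simp
    · simp [add_assoc, ← Pi.single_add, CharTwo.add_self_eq_zero]

open Classical in
theorem lift_chainPerm_mk (w : List (α × Bool)) (x : Ω) :
    lift (chainPerm Ω) (mk w) (x, 0) = (mk w • x, fun e => ((edges w x).count e : ZMod 2)) := by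
  induction w with
  | nil => simp [mk_nil, edges]; rfl
  | cons c w ih =>
    rw [mk_cons, _root_.map_mul, Equiv.Perm.mul_apply, ih]
    obtain ⟨a, b⟩ := c
    have hcount : ∀ e f : Ω × α, ((if f = e then 1 else 0 : ℕ) : ZMod 2) =
        (Pi.single f 1 : Ω × α → ZMod 2) e := by
      intro e f
      by_cases h : f = e
      · subst h; simp
      · simp [h]
    cases b
    · rw [mk_false, _root_.map_inv, lift_apply_of]
      ext1
      · simp [chainPerm, mul_smul, Equiv.Perm.inv_def]
      · funext e
        simp [chainPerm, Equiv.Perm.inv_def, edges, letterEdge, List.count_cons, hcount]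
    · rw [mk_true, lift_apply_of]
      ext1
      · simp [chainPerm, mul_smul]
      · funext e
        simp [chainPerm, edges, letterEdge, List.count_cons, hcount]

open Classical in
theorem exists_finiteIndex_even_count (Ω : Type*) [MulAction (FreeGroup α) Ω] [Finite α]
    [Finite Ω] : ∃ N : Subgroup (FreeGroup α), N.Normal ∧ N.FiniteIndex ∧
      ∀ w, mk w ∈ N → ∀ x : Ω, mk w • x = x ∧ ∀ e, Even ((edges w x).count e) := by
  refine ⟨(lift (chainPerm Ω)).ker, inferInstance, inferInstance, fun w hw x => ?_⟩
  have h := lift_chainPerm_mk w x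
  rw [MonoidHom.mem_ker.1 hw, Equiv.Perm.one_apply, Prod.mk.injEq] at h
  refine ⟨h.1.symm, fun e => ?_⟩
  have := congrFun h.2 e
  exact (ZMod.natCast_eq_zero_iff_even).1 (by simpa using this.symm)

end Edges

section Paths

variable [MulAction (FreeGroup α) Ω] {E E' : Set (Ω × α)} {p q r : Ω} {g h : FreeGroup α}

/-- The elements represented by words that label a path from `p` to `q` with all its edges
in `E`. -/
def paths (E : Set (Ω × α)) (p q : Ω) : Set (FreeGroup α) :=
  {g | ∃ w, mk w = g ∧ g • p = q ∧ ∀ e ∈ edges w p, e ∈ E}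

theorem smul_eq_of_mem_paths (hg : g ∈ paths E p q) : g • p = q := by
  obtain ⟨w, _, h, _⟩ := hg
  exact h

theorem paths_mono (hE : E ⊆ E') : paths E p q ⊆ paths E' p q := by
  rintro g ⟨w, h₁, h₂, h₃⟩
  exact ⟨w, h₁, h₂, fun e he => hE (h₃ e he)⟩

theorem one_mem_paths : (1 : FreeGroup α) ∈ paths E p p :=
  ⟨[], rfl, one_smul _ _, by simp [edges]⟩

theorem mul_mem_paths (hh : h ∈ paths E q r) (hg : g ∈ paths E p q) : h * g ∈ paths E p r := by
  obtain ⟨w, rfl, rfl, hw⟩ := hg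
  obtain ⟨v, rfl, rfl, hv⟩ := hh
  refine ⟨v ++ w, mul_mk.symm, mul_smul _ _ _, fun e he => ?_⟩
  rw [edges_append, List.mem_append] at he
  exact he.elim (hv e) (hw e)

theorem of_mem_paths {a : α} (ha : (p, a) ∈ E) : of a ∈ paths E p (of a • p) :=
  ⟨[(a, true)], rfl, rfl, by simpa [edges, letterEdge, mk_nil] using ha⟩

theorem of_inv_mem_paths {a : α} (ha : (p, a) ∈ E) : (of a)⁻¹ ∈ paths E (of a • p) p :=
  ⟨[(a, false)], rfl, inv_smul_smul _ _, by simpa [edges, letterEdge, mk_nil] using ha⟩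

theorem mk_mem_paths {w : List (α × Bool)} (hw : ∀ e ∈ edges w p, e ∈ E) :
    mk w ∈ paths E p (mk w • p) :=
  ⟨w, rfl, rfl, hw⟩

theorem inv_mem_paths (hg : g ∈ paths E p q) : g⁻¹ ∈ paths E q p := by
  obtain ⟨w, rfl, rfl, hw⟩ := hg
  induction w with
  | nil => simpa [mk_nil] using one_mem_paths
  | cons c w ih =>
    have hc : letterEdge c (mk w • p) ∈ E := hw _ (by simp [edges])
    rw [mk_cons, mul_inv_rev, mul_smul]
    refine mul_mem_paths (ih fun e he => hw e (by simp [edges, he])) ?_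
    obtain ⟨a, b⟩ := c
    cases b
    · simp only [letterEdge, Bool.false_eq_true, if_false] at hc
      simpa [mk_false] using of_mem_paths hc
    · exact of_inv_mem_paths hc

theorem inv_mul_mem_paths {a : α} (ha : (q, a) ∈ E) (hg : g ∈ paths E p (of a • q)) :
    (of a)⁻¹ * g ∈ paths E p q :=
  mul_mem_paths (of_inv_mem_paths ha) hg

/-- A path in `E` starting at `p` and the path with the same label starting at a point `x` of
another Schreier graph traverse corresponding edges. -/
theorem exists_mem_paths_of_mem_edges {X : Type*} [MulAction (FreeGroup α) X]
    {w : List (α × Bool)} (hw : ∀ e ∈ edges w p, e ∈ E) {x : X} {e : X × α}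
    (he : e ∈ edges w x) :
    ∃ g, g ∈ paths E p (g • p) ∧ (g • p, e.2) ∈ E ∧ e.1 = g • x := by
  induction w with
  | nil => simp [edges] at he
  | cons c w ih =>
    have htail : ∀ e ∈ edges w p, e ∈ E := fun e he => hw e (by simp [edges, he])
    rcases List.mem_cons.1 he with rfl | he
    · have hc : letterEdge c (mk w • p) ∈ E := hw _ (by simp [edges])
      obtain ⟨a, b⟩ := c
      cases b
      · simp only [letterEdge, Bool.false_eq_true, if_false] at hc
        refine ⟨(of a)⁻¹ * mk w, ?_, by simpa [mul_smul, letterEdge] using hc,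
          by simp [letterEdge, mul_smul]⟩
        refine inv_mul_mem_paths (by simpa [mul_smul] using hc) ?_
        simpa [mul_smul] using mk_mem_paths htail
      · exact ⟨mk w, mk_mem_paths htail, hc, rfl⟩
    · exact ih htail he

/-- A finite set of edges only sees a finite quotient of the free group. -/
theorem exists_finiteIndex_eq_of_mem_paths (hE : E.Finite) :
    ∃ N : Subgroup (FreeGroup α), N.Normal ∧ N.FiniteIndex ∧
      ∀ g ∈ N, ∀ p q, g ∈ paths E p q → p = q := by
  classical
  let W : Set Ω := Prod.fst '' E ∪ (fun e => of e.2 • e.1) '' E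
  have hW : W.Finite := (hE.image _).union (hE.image _)
  have : Finite W := hW
  have : Fintype W := Fintype.ofFinite W
  have hl : ∀ {z a}, (z, a) ∈ E → z ∈ W := fun h => Or.inl ⟨_, h, rfl⟩
  have hr : ∀ {z a}, (z, a) ∈ E → of a • z ∈ W := fun h => Or.inr ⟨_, h, rfl⟩
  let f (a : α) : {z : W // (z.1, a) ∈ E} ≃ {z : W // ((of a)⁻¹ • z.1, a) ∈ E} :=
    { toFun := fun z => ⟨⟨of a • z.1.1, hr z.2⟩, by simpa using z.2⟩
      invFun := fun z => ⟨⟨(of a)⁻¹ • z.1.1, hl z.2⟩, z.2⟩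
      left_inv := fun z => by ext; simp
      right_inv := fun z => by ext; simp }
  let π : FreeGroup α →* Equiv.Perm W := lift fun a => (f a).extendSubtype
  have hπ : ∀ {z a} (h : (z, a) ∈ E), π (of a) ⟨z, hl h⟩ = ⟨of a • z, hr h⟩ := by
    intro z a h
    simp only [π, lift_apply_of]
    rw [Equiv.extendSubtype_apply_of_mem (f a) ⟨z, hl h⟩ h]
    rfl
  have key : ∀ (p : W) (w : List (α × Bool)), (∀ e ∈ edges w p.1, e ∈ E) →
      (π (mk w) p : Ω) = mk w • p.1 := by
    intro p w hw
    induction w with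
    | nil => simp [mk_nil]
    | cons c w ih =>
      have hc : letterEdge c (mk w • p.1) ∈ E := hw _ (by simp [edges])
      have ih := ih fun e he => hw e (by simp [edges, he])
      rw [mk_cons, _root_.map_mul, Equiv.Perm.mul_apply, mul_smul]
      obtain ⟨a, b⟩ := c
      cases b
      · simp only [letterEdge, Bool.false_eq_true, if_false] at hc
        have h := hπ hc
        have h' : π (mk w) p = π (of a) ⟨_, hl hc⟩ := by
          rw [h]; ext; simp [ih]
        rw [h', mk_false, _root_.map_inv]
        simp
      · have h' : π (mk w) p = ⟨_, hl hc⟩ := Subtype.ext ih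
        rw [h', mk_true, hπ hc]
  refine ⟨π.ker, inferInstance, inferInstance, ?_⟩
  rintro _ hg p q ⟨w, rfl, rfl, hw⟩
  by_cases hp : p ∈ W
  · rw [← key ⟨p, hp⟩ w hw, MonoidHom.mem_ker.1 hg, Equiv.Perm.one_apply]
  · suffices w = [] by simp [this, mk_nil]
    clear hg
    induction w with
    | nil => rfl
    | cons c w ih =>
      have hc : letterEdge c (mk w • p) ∈ E := hw _ (by simp [edges])
      rw [ih fun e he => hw e (by simp [edges, he]), mk_nil, one_smul] at hc
      obtain ⟨a, b⟩ := c
      cases b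
      · simp only [letterEdge, Bool.false_eq_true, if_false] at hc
        exact absurd (by simpa using hr hc) hp
      · exact absurd (hl hc) hp

end Paths

section Products

variable [MulAction (FreeGroup α) Ω] {E : Set (Ω × α)}

/-- The product of the sets `paths E p q`, for `(p, q)` running through a list. -/
def pathsProd (E : Set (Ω × α)) (l : List (Ω × Ω)) : Set (FreeGroup α) :=
  (l.map fun pq => paths E pq.1 pq.2).prod

theorem pathsProd_cons (p q : Ω) (l : List (Ω × Ω)) :
    pathsProd E ((p, q) :: l) = paths E p q * pathsProd E l := by
  simp [pathsProd]

theorem pathsProd_singleton (p q : Ω) : pathsProd E [(p, q)] = paths E p q := by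
  simp [pathsProd]

theorem mul_mem_pathsProd_append {l₁ l₂ : List (Ω × Ω)} {p q r : Ω} {g h : FreeGroup α}
    (hg : g ∈ pathsProd E (l₁ ++ [(r, q)])) (hh : h ∈ pathsProd E ((p, r) :: l₂)) :
    g * h ∈ pathsProd E (l₁ ++ (p, q) :: l₂) := by
  simp only [pathsProd, List.map_append, List.prod_append, List.map_cons, List.prod_cons,
    List.map_nil, List.prod_nil, mul_one] at hg hh ⊢
  obtain ⟨a, ha, b, hb, rfl⟩ := Set.mem_mul.1 hg
  obtain ⟨c, hc, d, hd, rfl⟩ := Set.mem_mul.1 hh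
  rw [show a * b * (c * d) = a * (b * c * d) by group]
  exact Set.mul_mem_mul ha (Set.mul_mem_mul (mul_mem_paths hb hc) hd)

/-- Every way to cut a word into two pieces splits a suitable labelled path. -/
theorem mk_mem_paths_of_append {p q : Ω} {t s : List (α × Bool)}
    (hw : ∀ e ∈ edges (t ++ s) p, e ∈ E) (hq : mk (t ++ s) • p = q) :
    mk s ∈ paths E p (mk s • p) ∧ mk t ∈ paths E (mk s • p) q := by
  rw [edges_append] at hw
  refine ⟨mk_mem_paths fun e he => hw e (List.mem_append_right _ he), t, rfl, ?_,
    fun e he => hw e (List.mem_append_left _ he)⟩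
  rw [← mul_smul, mul_mk, hq]

theorem exists_word_of_mem_pathsProd {l : List (Ω × Ω)} (hl : l ≠ []) {g : FreeGroup α}
    (hg : g ∈ pathsProd E l) :
    ∃ w, mk w = g ∧ ∀ t s, w = t ++ s → ∃ l₁ p q r l₂, l = l₁ ++ (p, q) :: l₂ ∧
      mk t ∈ pathsProd E (l₁ ++ [(r, q)]) ∧ mk s ∈ pathsProd E ((p, r) :: l₂) := by
  induction l generalizing g with
  | nil => exact absurd rfl hl
  | cons pq l ih =>
    obtain ⟨p, q⟩ := pq
    rw [pathsProd_cons] at hg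
    obtain ⟨_, ⟨u, rfl, hq, hu⟩, h, hh, rfl⟩ := Set.mem_mul.1 hg
    by_cases hl' : l = []
    · subst hl'
      obtain rfl : h = 1 := hh
      refine ⟨u, (mul_one _).symm, ?_⟩
      rintro t s rfl
      obtain ⟨h₁, h₂⟩ := mk_mem_paths_of_append hu hq
      exact ⟨[], p, q, _, [], rfl, by simpa [pathsProd_singleton] using h₂,
        by simpa [pathsProd_singleton] using h₁⟩
    · obtain ⟨v, rfl, hv⟩ := ih hl' hh
      refine ⟨u ++ v, mul_mk.symm, fun t s hts => ?_⟩
      rcases List.append_eq_append_iff.1 hts with ⟨t', rfl, rfl⟩ | ⟨s', rfl, rfl⟩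
      · obtain ⟨l₁, p', q', r, l₂, rfl, h₁, h₂⟩ := hv _ _ rfl
        refine ⟨(p, q) :: l₁, p', q', r, l₂, rfl, ?_, h₂⟩
        rw [List.cons_append, pathsProd_cons, ← mul_mk]
        exact Set.mul_mem_mul ⟨u, rfl, hq, hu⟩ h₁
      · obtain ⟨h₁, h₂⟩ := mk_mem_paths_of_append hu hq
        refine ⟨[], p, q, _, l, rfl, by simpa [pathsProd_singleton] using h₂, ?_⟩
        rw [pathsProd_cons, ← mul_mk]
        exact Set.mul_mem_mul h₁ hh

/-- If a product of at most `n` path sets meets `N`, then it contains `1`. -/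
def Separates (N : Subgroup (FreeGroup α)) (E : Set (Ω × α)) (n : ℕ) : Prop :=
  ∀ l : List (Ω × Ω), l.length ≤ n → ∀ g ∈ N, g ∈ pathsProd E l → 1 ∈ pathsProd E l

theorem Separates.eq {N : Subgroup (FreeGroup α)} {n : ℕ} (h : Separates N E n) (hn : 1 ≤ n)
    {p q : Ω} {g : FreeGroup α} (hg : g ∈ N) (hg' : g ∈ paths E p q) : p = q := by
  have := h [(p, q)] hn g hg (by rwa [pathsProd_singleton])
  rw [pathsProd_singleton] at this
  simpa using smul_eq_of_mem_paths this

theorem Separates.eq_of_mk_eq {N : Subgroup (FreeGroup α)} [N.Normal] {n : ℕ}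
    (hs : Separates N E n) (hn : 1 ≤ n) {p q r : Ω} {g h : FreeGroup α} (hg : g ∈ paths E p q)
    (hh : h ∈ paths E p r) (hgh : (g : FreeGroup α ⧸ N) = h) : q = r := by
  refine hs.eq hn (g := h * g⁻¹) ?_ (mul_mem_paths hh (inv_mem_paths hg))
  exact (QuotientGroup.eq_iff_div_mem.1 hgh.symm) |> fun h => by rwa [div_eq_mul_inv] at h

open Classical in
/-- The subgroup `N'` forces closed paths in the Cayley graph of `F ⧸ N` to traverse every edge an
even number of times. -/
def ForcesEven (N' N : Subgroup (FreeGroup α)) : Prop :=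
  ∀ w, mk w ∈ N' → mk w ∈ N ∧
    ∀ e : (FreeGroup α ⧸ N) × α, Even ((edges w ((1 : FreeGroup α) : FreeGroup α ⧸ N)).count e)

theorem exists_forcesEven [Finite α] (N : Subgroup (FreeGroup α)) [N.FiniteIndex] :
    ∃ N' : Subgroup (FreeGroup α), N'.Normal ∧ N'.FiniteIndex ∧ ForcesEven N' N := by
  have : Finite (FreeGroup α ⧸ N) := N.finite_quotient_of_finiteIndex
  obtain ⟨N', h₁, h₂, h₃⟩ := exists_finiteIndex_even_count (α := α) (FreeGroup α ⧸ N)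
  refine ⟨N', h₁, h₂, fun w hw => ?_⟩
  obtain ⟨h, h'⟩ := h₃ w hw ((1 : FreeGroup α) : FreeGroup α ⧸ N)
  refine ⟨?_, by convert h'⟩
  rw [MulAction.Quotient.smul_coe, smul_eq_mul, mul_one] at h
  simpa using QuotientGroup.eq.1 h.symm

variable {N N' : Subgroup (FreeGroup α)}

/-- A product of two path sets meeting `N'` contains `1`. -/
theorem ForcesEven.exists_mem_paths [N.Normal] (hN : ForcesEven N' N) {n : ℕ}
    (hs : Separates N E n) (hn : 1 ≤ n) {p₁ q₁ p₂ q₂ : Ω} {g₁ g₂ : FreeGroup α}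
    (hg₁ : g₁ ∈ paths E p₁ q₁) (hg₂ : g₂ ∈ paths E p₂ q₂) (hg : g₁ * g₂ ∈ N') :
    ∃ v, v ∈ paths E p₁ q₁ ∧ v⁻¹ ∈ paths E p₂ q₂ := by
  classical
  obtain ⟨u₁, rfl, hq₁, hu₁⟩ := id hg₁
  obtain ⟨u₂, rfl, hq₂, hu₂⟩ := id hg₂
  rw [mul_mk] at hg
  obtain ⟨hmem, heven⟩ := hN _ hg
  let o : FreeGroup α ⧸ N := (1 : FreeGroup α)
  have ho : ∀ g : FreeGroup α, g • o = g := fun g => congrArg _ (mul_one g)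
  have hsmul : ∀ g h : FreeGroup α, g • (h : FreeGroup α ⧸ N) = g * h := fun _ _ => rfl
  let C : Set (FreeGroup α ⧸ N) := {z | ∃ v, v ∈ paths E p₁ (v • p₁) ∧ v ∈ paths E q₂ (v • q₂) ∧
    z = v • mk u₂ • o}
  have hC := mem_iff_smul_mem_of_odd C u₁ (mk u₂ • o) ?_
  · obtain ⟨v, hv₁, hv₂, hv⟩ := hC.1 ⟨1, by simpa using one_mem_paths,
      by simpa using one_mem_paths, (one_smul _ _).symm⟩
    have h₁ : v • p₁ = q₁ := by
      refine hs.eq_of_mk_eq hn hv₁ hg₁ ?_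
      rw [ho, hsmul, hsmul] at hv
      exact (mul_right_cancel hv).symm
    have h₂ : p₂ = v • q₂ := by
      refine hs.eq_of_mk_eq hn one_mem_paths (mul_mem_paths hv₂ hg₂) ?_
      rw [ho, hsmul, hsmul] at hv
      rw [QuotientGroup.mk_mul, ← hv, ← QuotientGroup.mk_mul, mul_mk]
      exact ((QuotientGroup.eq_one_iff _).2 hmem).symm
    exact ⟨v, h₁ ▸ hv₁, inv_mem_paths (h₂ ▸ hv₂)⟩
  · rintro ⟨z, a⟩ hodd
    have he : Even ((edges u₁ (mk u₂ • o)).count (z, a) + (edges u₂ o).count (z, a)) := by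
      rw [← List.count_append, ← edges_append]
      convert heven (z, a)
    have hodd₁ : Odd ((edges u₁ (mk u₂ • o)).count (z, a)) := by convert hodd
    have hodd₂ : Odd ((edges u₂ o).count (z, a)) := by
      rw [Nat.even_add'] at he
      exact he.1 hodd₁
    obtain ⟨g₁, hg₁', hE₁, hz₁⟩ :=
      exists_mem_paths_of_mem_edges hu₁ (List.count_pos_iff.1 hodd₁.pos)
    obtain ⟨g₂, hg₂', hE₂, hz₂⟩ :=
      exists_mem_paths_of_mem_edges hu₂ (List.count_pos_iff.1 hodd₂.pos)
    dsimp only at hE₁ hz₁ hE₂ hz₂ ⊢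
    constructor
    · rintro ⟨v, hv₁, hv₂, hv⟩
      have e₁ : v • p₁ = g₁ • p₁ := by
        refine hs.eq_of_mk_eq hn hv₁ hg₁' ?_
        have := hv.symm.trans hz₁
        rw [ho, hsmul, hsmul] at this
        exact mul_right_cancel this
      have e₂ : v • q₂ = g₂ • p₂ := by
        refine hs.eq_of_mk_eq hn (mul_mem_paths hv₂ hg₂) hg₂' ?_
        have := hv.symm.trans hz₂
        rwa [ho, ho] at this
      refine ⟨of a * v, ?_, ?_, by rw [hv, mul_smul]⟩
      · rw [mul_smul]
        exact mul_mem_paths (of_mem_paths (e₁ ▸ hE₁)) hv₁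
      · rw [mul_smul]
        exact mul_mem_paths (of_mem_paths (e₂ ▸ hE₂)) hv₂
    · rintro ⟨v, hv₁, hv₂, hv⟩
      have e₁ : v • p₁ = of a • g₁ • p₁ := by
        refine hs.eq_of_mk_eq hn hv₁ (mul_mem_paths (of_mem_paths hE₁) hg₁') ?_
        have := hv.symm
        rw [hz₁] at this
        rw [ho, hsmul, hsmul] at this
        exact mul_right_cancel (this.trans (mul_assoc (of a : FreeGroup α ⧸ N) g₁ (mk u₂)).symm)
      have e₂ : v • q₂ = of a • g₂ • p₂ := by
        refine hs.eq_of_mk_eq hn (mul_mem_paths hv₂ hg₂)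
          (mul_mem_paths (of_mem_paths hE₂) hg₂') ?_
        have := hv.symm
        rw [hz₂] at this
        rwa [ho, ho] at this
      refine ⟨(of a)⁻¹ * v, ?_, ?_, by rw [mul_smul, ← hv, inv_smul_smul]⟩
      · have := inv_mul_mem_paths hE₁ (e₁ ▸ hv₁)
        rwa [mul_smul, e₁, inv_smul_smul]
      · have := inv_mul_mem_paths hE₂ (e₂ ▸ hv₂)
        rwa [mul_smul, e₂, inv_smul_smul]

/-- If a closed path is cut into three pieces, then the pieces have a common vertex. -/
theorem ForcesEven.exists_common_vertex (hN : ForcesEven N' N) (u₁ u₂ u₃ : List (α × Bool))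
    (hu : mk (u₁ ++ (u₂ ++ u₃)) ∈ N') :
    ∃ t₁ s₁ t₂ s₂ t₃ s₃, u₁ = t₁ ++ s₁ ∧ u₂ = t₂ ++ s₂ ∧ u₃ = t₃ ++ s₃ ∧
      ((mk s₁ * mk u₂ * mk u₃ : FreeGroup α) : FreeGroup α ⧸ N) = (mk s₃ : FreeGroup α) ∧
      ((mk s₂ * mk u₃ : FreeGroup α) : FreeGroup α ⧸ N) = (mk s₃ : FreeGroup α) := by
  classical
  obtain ⟨hmem, heven⟩ := hN _ hu
  let o : FreeGroup α ⧸ N := (1 : FreeGroup α)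
  have ho : ∀ g : FreeGroup α, g • o = g := fun g => congrArg _ (mul_one g)
  let V (u : List (α × Bool)) (x : FreeGroup α ⧸ N) : Set (FreeGroup α ⧸ N) :=
    {z | ∃ t s, u = t ++ s ∧ z = mk s • x}
  suffices ∃ z, z ∈ V u₁ (mk u₂ • mk u₃ • o) ∧ z ∈ V u₂ (mk u₃ • o) ∧ z ∈ V u₃ o by
    obtain ⟨z, ⟨t₁, s₁, h₁, hz₁⟩, ⟨t₂, s₂, h₂, hz₂⟩, t₃, s₃, h₃, hz₃⟩ := this
    refine ⟨t₁, s₁, t₂, s₂, t₃, s₃, h₁, h₂, h₃, ?_, ?_⟩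
    · rw [← ho, ← ho (mk s₃), ← hz₃, hz₁, mul_smul, mul_smul]
    · rw [← ho, ← ho (mk s₃), ← hz₃, hz₂, mul_smul]
  by_contra! hnot
  have hC := mem_iff_smul_mem_of_odd (V u₂ (mk u₃ • o)) u₁ (mk u₂ • mk u₃ • o) ?_
  · have h₁ : mk u₁ • mk u₂ • mk u₃ • o = o := by
      rw [← mul_smul, ← mul_smul, mul_mk, mul_mk, ho]
      simp only [o]
      rw [eq_comm, QuotientGroup.eq]
      simpa using hmem
    have h₂ := hC.1 ⟨[], u₂, rfl, rfl⟩
    rw [h₁] at h₂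
    exact hnot o ⟨[], u₁, rfl, h₁.symm⟩ h₂ ⟨u₃, [], by simp, by simp [mk_nil]⟩
  · rintro ⟨z, a⟩ hodd
    have hodd₁ : Odd ((edges u₁ (mk u₂ • mk u₃ • o)).count (z, a)) := by convert hodd
    have he : Even ((edges u₁ (mk u₂ • mk u₃ • o)).count (z, a) +
        (edges u₂ (mk u₃ • o) ++ edges u₃ o).count (z, a)) := by
      rw [← List.count_append, ← edges_append, ← mul_smul, mul_mk, ← edges_append]
      convert heven (z, a)
    rw [Nat.even_add'] at he
    have hmem' := List.count_pos_iff.1 (he.1 hodd₁).pos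
    obtain ⟨hz, haz⟩ := exists_suffix_of_mem_edges (List.count_pos_iff.1 hodd₁.pos)
    rcases List.mem_append.1 hmem' with h | h
    · obtain ⟨h₁, h₂⟩ := exists_suffix_of_mem_edges h
      exact iff_of_true h₁ h₂
    · obtain ⟨h₁, h₂⟩ := exists_suffix_of_mem_edges h
      exact iff_of_false (fun h => hnot _ hz h h₁) (fun h => hnot _ haz h h₂)

theorem ForcesEven.separates_succ [N.Normal] (hN : ForcesEven N' N) {n : ℕ} (hn : 1 ≤ n)
    (hs : Separates N E n) : Separates N' E (n + 1) := by
  intro l hl g hg hgl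
  match l with
  | [] => exact Set.one_mem_one
  | [(p, q)] =>
    rw [pathsProd_singleton] at hgl ⊢
    obtain ⟨w, rfl, -, -⟩ := id hgl
    rw [hs.eq hn (hN _ hg).1 hgl]
    exact one_mem_paths
  | [(p₁, q₁), (p₂, q₂)] =>
    rw [pathsProd_cons, pathsProd_singleton] at hgl ⊢
    obtain ⟨g₁, hg₁, g₂, hg₂, rfl⟩ := Set.mem_mul.1 hgl
    obtain ⟨v, hv, hv'⟩ := hN.exists_mem_paths hs hn hg₁ hg₂ hg
    exact ⟨v, hv, v⁻¹, hv', mul_inv_cancel v⟩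
  | (p₁, q₁) :: (p₂, q₂) :: pq :: l =>
    rw [pathsProd_cons, pathsProd_cons] at hgl
    obtain ⟨_, ⟨u₁, rfl, hq₁, hu₁⟩, _, hgl', rfl⟩ := Set.mem_mul.1 hgl
    obtain ⟨_, ⟨u₂, rfl, hq₂, hu₂⟩, g₃, hg₃, rfl⟩ := Set.mem_mul.1 hgl'
    obtain ⟨u₃, rfl, hsplit⟩ := exists_word_of_mem_pathsProd (List.cons_ne_nil _ _) hg₃
    rw [mul_mk, mul_mk] at hg
    obtain ⟨hmem, -⟩ := hN _ hg
    obtain ⟨t₁, s₁, t₂, s₂, t₃, s₃, rfl, rfl, rfl, h₁, h₂⟩ := hN.exists_common_vertex _ _ _ hg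
    obtain ⟨l₁, p, q, r, l₂, hl₁₂, ht₃, hs₃⟩ := hsplit _ _ rfl
    obtain ⟨ps₁, pt₁⟩ := mk_mem_paths_of_append hu₁ hq₁
    obtain ⟨ps₂, pt₂⟩ := mk_mem_paths_of_append hu₂ hq₂
    have hlen : l₁.length + l₂.length = l.length := by
      have := congrArg List.length hl₁₂
      simp only [List.length_cons, List.length_append] at this
      omega
    simp only [List.length_cons] at hl
    simp only [← mul_mk] at h₁ h₂ hmem
    simp only [← QuotientGroup.eq_one_iff, QuotientGroup.mk_mul] at h₁ h₂ hmem
    have hx : 1 ∈ pathsProd E ((mk s₁ • p₁, q₁) :: (p, r) :: l₂) := by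
      refine hs _ ?_ (mk t₁ * mk s₃) ?_ ?_
      · simp only [List.length_cons]; omega
      · rw [← QuotientGroup.eq_one_iff, QuotientGroup.mk_mul, ← h₁, ← hmem]
        group
      · rw [pathsProd_cons]
        exact Set.mul_mem_mul pt₁ hs₃
    have hy : 1 ∈ pathsProd E [(p₁, mk s₁ • p₁), (mk s₂ • p₂, q₂)] := by
      refine hs _ ?_ (mk s₁ * mk t₂) ?_ ?_
      · simp only [List.length_cons, List.length_nil]; omega
      · rw [← QuotientGroup.eq_one_iff, QuotientGroup.mk_mul]
        have h := h₁.trans h₂.symm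
        refine mul_eq_right (b := (mk s₂ * (mk t₃ * mk s₃) : FreeGroup α ⧸ N)).1 ?_
        simpa only [mul_assoc] using h
      · rw [pathsProd_cons, pathsProd_singleton]
        exact Set.mul_mem_mul ps₁ pt₂
    have hz : 1 ∈ pathsProd E ((p₂, mk s₂ • p₂) :: (l₁ ++ [(r, q)])) := by
      refine hs _ ?_ (mk s₂ * mk t₃) ?_ ?_
      · simp only [List.length_cons, List.length_append, List.length_nil]; omega
      · rw [← QuotientGroup.eq_one_iff, QuotientGroup.mk_mul]
        simpa [← mul_assoc] using h₂
      · rw [pathsProd_cons]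
        exact Set.mul_mem_mul ps₂ ht₃
    rw [pathsProd_cons] at hx hy hz
    rw [pathsProd_singleton] at hy
    obtain ⟨x, hx, A, hA, hxA⟩ := Set.mem_mul.1 hx
    obtain ⟨y₁, hy₁, y₂, hy₂, hy⟩ := Set.mem_mul.1 hy
    obtain ⟨z, hz, B, hB, hzB⟩ := Set.mem_mul.1 hz
    rw [hl₁₂, pathsProd_cons, pathsProd_cons]
    have := Set.mul_mem_mul (mul_mem_paths hx hy₁)
      (Set.mul_mem_mul (mul_mem_paths hy₂ hz) (mul_mem_pathsProd_append hB hA))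
    convert this using 1
    calc 1 = x * A := hxA.symm
      _ = x * (y₁ * y₂) * (z * B) * A := by rw [hy, hzB]; group
      _ = _ := by group

theorem exists_separates [Finite α] (hE : E.Finite) (n : ℕ) :
    ∃ N : Subgroup (FreeGroup α), N.Normal ∧ N.FiniteIndex ∧ Separates N E (n + 1) := by
  induction n with
  | zero =>
    obtain ⟨N, h₁, h₂, h₃⟩ := exists_finiteIndex_eq_of_mem_paths hE
    refine ⟨N, h₁, h₂, fun l hl g hg hgl => ?_⟩
    match l with
    | [] => exact Set.one_mem_one
    | [(p, q)] =>
      rw [pathsProd_singleton] at hgl ⊢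
      rw [h₃ g hg p q hgl]
      exact one_mem_paths
  | succ n ih =>
    obtain ⟨N, h₁, h₂, h₃⟩ := ih
    obtain ⟨N', h₁', h₂', h₃'⟩ := exists_forcesEven N
    exact ⟨N', h₁', h₂', h₃'.separates_succ (by omega) h₃⟩

end Products

section Subgroups

/-- The disjoint union of all coset spaces of the free group on `α`. -/
abbrev AllCosets (α : Type*) : Type _ := Σ K : Subgroup (FreeGroup α), FreeGroup α ⧸ K

/-- The coset `gK`, as a point of the disjoint union of all coset spaces. -/
def coset (K : Subgroup (FreeGroup α)) (g : FreeGroup α) : AllCosets α := ⟨K, (g : FreeGroup α ⧸ K)⟩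

theorem smul_coset (K : Subgroup (FreeGroup α)) (g h : FreeGroup α) :
    g • coset K h = coset K (g * h) := rfl

theorem coset_eq_coset_iff {K : Subgroup (FreeGroup α)} {g h : FreeGroup α} :
    coset K g = coset K h ↔ g⁻¹ * h ∈ K := by
  rw [← QuotientGroup.eq, coset, coset, Sigma.mk.injEq]
  simp

theorem exists_finite_mem_paths [MulAction (FreeGroup α) Ω] (g : FreeGroup α) (p : Ω) :
    ∃ E : Set (Ω × α), E.Finite ∧ g ∈ paths E p (g • p) := by
  obtain ⟨w, rfl⟩ := Quot.exists_rep g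
  exact ⟨{e | e ∈ edges w p}, List.finite_toSet _, w, rfl, rfl, fun e he => he⟩

/-- All elements of a finitely generated subgroup `K` label closed paths at the base point of a
finite subgraph of the coset graph of `K`. -/
theorem exists_finite_forall_mem_paths {K : Subgroup (FreeGroup α)} (hK : K.FG) :
    ∃ E : Set (AllCosets α × α), E.Finite ∧
      ∀ g ∈ K, g ∈ paths E (coset K 1) (coset K 1) := by
  obtain ⟨S, hS⟩ := hK
  choose E hE hE' using fun g : FreeGroup α => exists_finite_mem_paths g (coset K 1)
  refine ⟨⋃ g ∈ S, E g, S.finite_toSet.biUnion fun g _ => hE g, fun g hg => ?_⟩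
  rw [← hS] at hg
  induction hg using Subgroup.closure_induction with
  | mem g hg =>
    have hgK : g ∈ K := hS ▸ Subgroup.subset_closure hg
    have h : g ∈ paths (⋃ g ∈ S, E g) _ _ :=
      paths_mono (Set.subset_biUnion_of_mem (u := E) hg) (hE' g)
    have hK : g • coset K 1 = coset K 1 := by
      rw [smul_coset, coset_eq_coset_iff]
      simpa using hgK
    rwa [hK] at h
  | one => exact one_mem_paths
  | mul g h _ _ hg hh => exact mul_mem_paths hg hh
  | inv g _ hg => exact inv_mem_paths hg

/-- A finite product of finitely generated subgroups of a free group of finite rank is closed in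
the profinite topology. -/
theorem exists_finiteIndex_forall_prod_ne [Finite α] {n : ℕ} (H : Fin n → Subgroup (FreeGroup α))
    (hH : ∀ i, (H i).FG) (g : FreeGroup α)
    (hg : ∀ a : Fin n → FreeGroup α, (∀ i, a i ∈ H i) → (List.ofFn a).prod ≠ g) :
    ∃ N : Subgroup (FreeGroup α), N.Normal ∧ N.FiniteIndex ∧
      ∀ a : Fin n → FreeGroup α, (∀ i, a i ∈ H i) → g⁻¹ * (List.ofFn a).prod ∉ N := by
  choose E hE hE' using fun i => exists_finite_forall_mem_paths (hH i)
  obtain ⟨D, hD, hD'⟩ := exists_finite_mem_paths g⁻¹ (coset (⊥ : Subgroup (FreeGroup α)) 1)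
  obtain ⟨N, h₁, h₂, h₃⟩ := exists_separates (hD.union (Set.finite_iUnion hE)) n
  refine ⟨N, h₁, h₂, fun a ha haN => ?_⟩
  let l : List (AllCosets α × AllCosets α) :=
    List.ofFn fun i => (coset (H i) 1, coset (H i) 1)
  have h := h₃ ((coset ⊥ 1, g⁻¹ • coset ⊥ 1) :: l) (by simp [l]) _ haN ?_
  · rw [pathsProd_cons, pathsProd, List.map_ofFn] at h
    obtain ⟨x, hx, y, hy, hxy⟩ := Set.mem_mul.1 h
    obtain ⟨b, rfl⟩ := Set.mem_prod_list_ofFn.1 hy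
    have hxg : x = g⁻¹ := by
      have := smul_eq_of_mem_paths hx
      rw [smul_coset, smul_coset, coset_eq_coset_iff, Subgroup.mem_bot] at this
      simpa [inv_mul_eq_one] using this
    refine hg (fun i => b i) (fun i => ?_) ?_
    · have := smul_eq_of_mem_paths (b i).2
      rw [smul_coset, eq_comm, coset_eq_coset_iff] at this
      simpa using this
    · rwa [hxg, inv_mul_eq_one, eq_comm] at hxy
  · rw [pathsProd_cons, pathsProd, List.map_ofFn]
    refine Set.mul_mem_mul (paths_mono Set.subset_union_left hD') ?_
    refine Set.mem_prod_list_ofFn.2 ⟨fun i => ⟨a i, ?_⟩, rfl⟩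
    exact paths_mono ((Set.subset_iUnion E i).trans Set.subset_union_right) (hE' i _ (ha i))

end Subgroups

end FreeGroup

/-- Ribes–Zalesskii: if `H₁, …, Hₙ` are finitely generated subgroups of a
free group `F` of finite rank and `g ∉ H₁H₂⋯Hₙ`, then there is a homomorphism `φ` from `F`
to a finite group `Q` with `φ(g) ∉ φ(H₁)φ(H₂)⋯φ(Hₙ)`; i.e. the product of finitely many
finitely generated subgroups is closed in the profinite topology. -/
theorem ribes_zalesskii
    (k n : ℕ) (H : Fin n → Subgroup (FreeGroup (Fin k)))
    (hfg : ∀ i, (H i).FG)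
    (g : FreeGroup (Fin k))
    (hg : g ∉ setwiseProd (fun i => (H i : Set (FreeGroup (Fin k))))) :
    ∃ Q : BGrp, Finite Q.carrier ∧
      ∃ φ : FreeGroup (Fin k) →* Q.carrier,
        φ g ∉ setwiseProd (fun i => φ '' (H i : Set (FreeGroup (Fin k)))) := by
  obtain ⟨N, hN, hfin, h⟩ := FreeGroup.exists_finiteIndex_forall_prod_ne H hfg g
    fun a ha hag => hg ⟨a, ha, hag.symm⟩
  refine ⟨⟨FreeGroup (Fin k) ⧸ N⟩, N.finite_quotient_of_finiteIndex, QuotientGroup.mk' N, ?_⟩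
  rintro ⟨b, hb, hgb⟩
  choose a ha hab using hb
  refine h a ha (QuotientGroup.eq.1 (hgb.trans ?_))
  rw [← QuotientGroup.mk'_apply, map_list_prod, List.map_ofFn]
  exact congrArg (fun f => (List.ofFn f).prod) (funext fun i => (hab i).symm)
end

section
/- (Pin–Reutenauer reduction) Assume that for every free group F of finite rank, all finitely generated subgroups H₁, …, Hₙ of F, and every g ∈ F not in the setwise product H₁⋯Hₙ, there exist a finite group Q and a homomorphism φ : F → Q with φ(g) ∉ φ(H₁)⋯φ(Hₙ). Then for every finite semigroup S, every type II element of S belongs to D(S); that is, K(S) ⊆ D(S). -/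
/-- An element `s` of a (finite) semigroup `S` is of *type II* if for every finite group `G`
and every relational morphism `R` from `S` to `G` (a subsemigroup of `S × G` projecting onto
`S`) one has `(s, 1) ∈ R`.  The set of type II elements is the group kernel `K(S)`. -/
def IsTypeII {S : Type} [Semigroup S] (s : S) : Prop :=
  ∀ (G : Type) [Group G] [Finite G] (R : Subsemigroup (S × G)),
    (∀ x : S, ∃ g : G, (x, g) ∈ R) → (s, (1 : G)) ∈ R

/-- A subsemigroup `T` of `S` is closed under weak conjugation if whenever `s·t·s = s`,
`s·T·t ⊆ T` and `t·T·s ⊆ T`. -/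
def WeakConjClosed {S : Type} [Semigroup S] (T : Subsemigroup S) : Prop :=
  ∀ s t : S, s * t * s = s → ∀ x ∈ T, s * x * t ∈ T ∧ t * x * s ∈ T

/-- `D(S)`: the smallest subsemigroup of `S` containing all idempotents and closed under
weak conjugation. -/
def DSub (S : Type) [Semigroup S] : Subsemigroup S :=
  sInf {T : Subsemigroup S | (∀ e : S, e * e = e → e ∈ T) ∧ WeakConjClosed T}

open scoped Pointwise

namespace PinReutenauer

/-! ### Finite unions of translated products of finitely generated subgroups -/

section Rational

variable {F : Type} [Group F]

/-- The product `H₁ ⋯ Hₙ` of a list of subgroups, as a set. -/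
def listProd (Hs : List (Subgroup F)) : Set F :=
  (Hs.map fun H : Subgroup F => (H : Set F)).prod

/-- Finite unions of sets `H₁ ⋯ Hₙ g` with the `Hᵢ` finitely generated subgroups. -/
inductive ProductUnion : Set F → Prop
  | empty : ProductUnion ∅
  | union (Hs : List (Subgroup F)) (hHs : ∀ H ∈ Hs, H.FG) (g : F) (C : Set F) :
      ProductUnion C → ProductUnion (listProd Hs * {g} ∪ C)

theorem ProductUnion.coset (Hs : List (Subgroup F)) (hHs : ∀ H ∈ Hs, H.FG) (g : F) :
    ProductUnion (listProd Hs * {g}) := by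
  simpa using ProductUnion.union Hs hHs g ∅ .empty

theorem ProductUnion.singleton (g : F) : ProductUnion ({g} : Set F) := by
  have h : listProd ([] : List (Subgroup F)) * {g} = {g} := by
    rw [listProd, List.map_nil, List.prod_nil, one_mul]
  exact h ▸ ProductUnion.coset [] (by simp) g

theorem ProductUnion.sup {A B : Set F} (hA : ProductUnion A) (hB : ProductUnion B) :
    ProductUnion (A ∪ B) := by
  induction hA with
  | empty => simpa using hB
  | union Hs hHs g C _ ih => simpa [Set.union_assoc] using ProductUnion.union Hs hHs g _ ih

theorem ProductUnion.of_finite {A : Set F} (hA : A.Finite) : ProductUnion A := by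
  induction A, hA using Set.Finite.induction_on with
  | empty => exact .empty
  | @insert a B _ _ ih => exact Set.insert_eq a B ▸ (ProductUnion.singleton a).sup ih

theorem ProductUnion.subgroup {H : Subgroup F} (hH : H.FG) : ProductUnion (H : Set F) := by
  simpa [listProd] using ProductUnion.coset [H] (by simpa using hH) 1

theorem singleton_mul_listProd (g : F) (Hs : List (Subgroup F)) :
    {g} * listProd Hs = listProd (Hs.map fun H => H.map (MulAut.conj g).toMonoidHom) * {g} := by
  induction Hs with
  | nil => simp [listProd]
  | cons H Hs ih =>
    have key : ({g} : Set F) * (H : Set F)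
        = (H.map (MulAut.conj g).toMonoidHom : Set F) * {g} := by
      ext x
      simp only [Set.singleton_mul, Set.mul_singleton, Set.mem_image, SetLike.mem_coe,
        Subgroup.mem_map]
      constructor
      · rintro ⟨y, hy, rfl⟩
        exact ⟨_, ⟨y, hy, rfl⟩, by simp⟩
      · rintro ⟨_, ⟨y, hy, rfl⟩, rfl⟩
        exact ⟨y, hy, by simp⟩
    have cons (K : Subgroup F) (Ks) : listProd (K :: Ks) = (K : Set F) * listProd Ks := by
      simp [listProd]
    rw [List.map_cons, cons, cons, ← mul_assoc, key, mul_assoc, ih, mul_assoc]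

theorem coset_mul_coset (Hs Ks : List (Subgroup F)) (g k : F) :
    listProd Hs * {g} * (listProd Ks * {k})
      = listProd (Hs ++ Ks.map fun H => H.map (MulAut.conj g).toMonoidHom) * {g * k} := by
  have happ (As Bs : List (Subgroup F)) : listProd (As ++ Bs) = listProd As * listProd Bs := by
    simp [listProd]
  rw [happ, mul_assoc (listProd Hs), ← mul_assoc ({g} : Set F), singleton_mul_listProd,
    mul_assoc _ ({g} : Set F) {k}, Set.singleton_mul_singleton, ← mul_assoc]

theorem fg_map {G : Type} [Group G] {H : Subgroup F} (hH : H.FG) (f : F →* G) :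
    (H.map f).FG := by
  rw [Subgroup.fg_iff_submonoid_fg] at hH ⊢
  exact hH.map f

theorem ProductUnion.mul {A B : Set F} (hA : ProductUnion A) (hB : ProductUnion B) :
    ProductUnion (A * B) := by
  induction hA with
  | empty => simpa using ProductUnion.empty
  | union Hs hHs g C _ ih =>
    rw [Set.union_mul]
    refine ProductUnion.sup ?_ ih
    clear ih
    induction hB with
    | empty => simpa using ProductUnion.empty
    | union Ks hKs k D _ ih =>
      rw [Set.mul_union, coset_mul_coset]
      refine ProductUnion.sup (.coset _ ?_ _) ih
      intro H hH
      rcases List.mem_append.1 hH with hH | hH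
      · exact hHs H hH
      · obtain ⟨K, hK, rfl⟩ := List.mem_map.1 hH
        exact fg_map (hKs K hK) _

theorem one_mem_listProd (Hs : List (Subgroup F)) : (1 : F) ∈ listProd Hs := by
  induction Hs with
  | nil => simp [listProd]
  | cons H Hs ih =>
    simpa [listProd] using Set.mul_mem_mul H.one_mem ih

theorem closure_listProd_fg (Hs : List (Subgroup F)) (hHs : ∀ H ∈ Hs, H.FG) :
    (Subgroup.closure (listProd Hs)).FG := by
  induction Hs with
  | nil =>
    rw [listProd, List.map_nil, List.prod_nil, ← Set.singleton_one, Subgroup.closure_singleton_one]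
    exact Subgroup.FG.bot
  | cons H Hs ih =>
    have : Subgroup.closure (listProd (H :: Hs)) = H ⊔ Subgroup.closure (listProd Hs) := by
      apply le_antisymm
      · rw [Subgroup.closure_le]
        rintro _ ⟨a, ha, b, hb, rfl⟩
        exact mul_mem (Subgroup.mem_sup_left ha)
          (Subgroup.mem_sup_right (Subgroup.subset_closure hb))
      · refine sup_le (fun a ha => Subgroup.subset_closure ?_) (Subgroup.closure_mono fun b hb => ?_)
        · simpa [listProd] using Set.mul_mem_mul ha (one_mem_listProd Hs)
        · simpa [listProd] using Set.mul_mem_mul H.one_mem hb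
    rw [this]
    exact (hHs H (by simp)).sup (ih fun K hK => hHs K (by simp [hK]))

theorem ProductUnion.closure_fg {A : Set F} (hA : ProductUnion A) :
    (Subgroup.closure A).FG := by
  induction hA with
  | empty => simpa using Subgroup.FG.bot
  | union Hs hHs g C _ ih =>
    rw [Subgroup.closure_union]
    refine Subgroup.FG.sup ?_ ih
    have : Subgroup.closure (listProd Hs * {g})
        = Subgroup.closure (listProd Hs) ⊔ Subgroup.closure {g} := by
      have hg : g ∈ Subgroup.closure (listProd Hs * {g}) :=
        Subgroup.subset_closure ⟨1, one_mem_listProd Hs, g, rfl, one_mul g⟩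
      apply le_antisymm
      · rw [Subgroup.closure_le]
        rintro _ ⟨a, ha, b, hb, rfl⟩
        exact mul_mem (Subgroup.mem_sup_left (Subgroup.subset_closure ha))
          (Subgroup.mem_sup_right (Subgroup.subset_closure hb))
      · refine sup_le ?_ ?_
        · rw [Subgroup.closure_le]
          intro a ha
          have := mul_mem (Subgroup.subset_closure (Set.mul_mem_mul ha (Set.mem_singleton g)))
            (inv_mem hg)
          simpa using this
        · simpa using hg
    rw [this]
    exact (closure_listProd_fg Hs hHs).sup ((Subgroup.fg_iff _).2 ⟨{g}, rfl, by simp⟩)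

/-- `C` is closed in the profinite topology. -/
def ProfinitelyClosed (C : Set F) : Prop :=
  ∀ x ∉ C, ∃ Q : BGrp, Finite Q.carrier ∧ ∃ φ : F →* Q.carrier, φ x ∉ φ '' C

theorem ProfinitelyClosed.sup {A B : Set F} (hA : ProfinitelyClosed A)
    (hB : ProfinitelyClosed B) : ProfinitelyClosed (A ∪ B) := by
  intro x hx
  obtain ⟨P, _, φ, hφ⟩ := hA x fun h => hx (.inl h)
  obtain ⟨Q, _, ψ, hψ⟩ := hB x fun h => hx (.inr h)
  refine ⟨⟨P.carrier × Q.carrier⟩, inferInstanceAs (Finite (P.carrier × Q.carrier)),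
    φ.prod ψ, ?_⟩
  rintro ⟨y, hy | hy, hxy⟩
  · exact hφ ⟨y, hy, congrArg Prod.fst hxy⟩
  · exact hψ ⟨y, hy, congrArg Prod.snd hxy⟩

theorem mem_setwiseProd_iff {Q : Type} [Group Q] {n : ℕ} (A : Fin n → Set Q) (x : Q) :
    x ∈ setwiseProd A ↔ x ∈ (List.ofFn A).prod := by
  rw [Set.mem_prod_list_ofFn]
  constructor
  · rintro ⟨a, ha, rfl⟩
    exact ⟨fun i => ⟨a i, ha i⟩, rfl⟩
  · rintro ⟨f, rfl⟩
    exact ⟨fun i => f i, fun i => (f i).2, rfl⟩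

theorem setwiseProd_get (Hs : List (Subgroup F)) {Q : Type} [Group Q] (φ : F →* Q) :
    setwiseProd (fun i : Fin Hs.length => φ '' (Hs.get i : Set F)) = φ '' listProd Hs := by
  ext x
  rw [mem_setwiseProd_iff]
  have h : (List.ofFn fun i : Fin Hs.length => φ '' (Hs.get i : Set F))
      = Hs.map fun H : Subgroup F => φ '' (H : Set F) := by
    conv_rhs => rw [← List.ofFn_get Hs, List.map_ofFn]
    rfl
  rw [h]
  suffices (Hs.map fun H : Subgroup F => φ '' (H : Set F)).prod = φ '' listProd Hs by rw [this]
  clear h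
  induction Hs with
  | nil => simp [listProd, Set.singleton_one]
  | cons H Hs ih =>
    simp only [listProd, List.map_cons, List.prod_cons] at ih ⊢
    rw [ih, Set.image_mul]

theorem ProductUnion.profinitelyClosed
    (hF : ∀ (n : ℕ) (H : Fin n → Subgroup F), (∀ i, (H i).FG) →
      ∀ g : F, g ∉ setwiseProd (fun i => (H i : Set F)) →
        ∃ Q : BGrp, Finite Q.carrier ∧ ∃ φ : F →* Q.carrier,
            φ g ∉ setwiseProd (fun i => φ '' (H i : Set F)))
    {C : Set F} (hC : ProductUnion C) : ProfinitelyClosed C := by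
  induction hC with
  | empty => exact fun x _ => ⟨⟨Unit⟩, inferInstanceAs (Finite Unit), 1, by simp⟩
  | union Hs hHs g C _ ih =>
    refine ProfinitelyClosed.sup (fun x hx => ?_) ih
    obtain ⟨Q, hQ, φ, hφ⟩ := hF Hs.length Hs.get (fun i => hHs _ (List.get_mem Hs i)) (x * g⁻¹) (by
      intro h
      have := setwiseProd_get Hs (MonoidHom.id F)
      simp only [MonoidHom.id_apply, Set.image_id'] at this
      rw [this] at h
      exact hx ⟨_, h, g, rfl, by simp⟩)
    refine ⟨Q, hQ, φ, ?_⟩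
    rw [setwiseProd_get] at hφ
    rintro ⟨_, ⟨y, hy, _, rfl, rfl⟩, hxy⟩
    exact hφ ⟨y, hy, by simp [← hxy]⟩

end Rational

/-! ### The relation generated by letters, weak inverses and idempotents -/

section Relation

variable {M : Type} [Monoid M] {k : ℕ} (π : Fin k → M)

/-- The submonoid of `M × F` generated by the pairs `(π a, a)`, `(y, a⁻¹)` with `y` a weak inverse
of `π a`, and `(e, 1)` with `e` idempotent. -/
def kernelRel : Submonoid (M × FreeGroup (Fin k)) :=
  Submonoid.closure
    ({p | ∃ a, p = (π a, FreeGroup.of a)} ∪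
      {p | ∃ a y, y * π a * y = y ∧ p = (y, (FreeGroup.of a)⁻¹)} ∪
      {p | ∃ e, e * e = e ∧ p = (e, 1)})

theorem letter_mem_kernelRel (a : Fin k) : (π a, FreeGroup.of a) ∈ kernelRel π :=
  Submonoid.subset_closure (.inl (.inl ⟨a, rfl⟩))

theorem weakInverse_mem_kernelRel {a : Fin k} {y : M} (h : y * π a * y = y) :
    (y, (FreeGroup.of a)⁻¹) ∈ kernelRel π :=
  Submonoid.subset_closure (.inl (.inr ⟨a, y, h, rfl⟩))

theorem idempotent_mem_kernelRel {e : M} (h : e * e = e) : (e, 1) ∈ kernelRel π :=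
  Submonoid.subset_closure (.inr ⟨e, h, rfl⟩)

theorem inv_mem_kernelRel {p : M × FreeGroup (Fin k)} (hp : p ∈ kernelRel π) :
    ∀ y, y * p.1 * y = y → (y, p.2⁻¹) ∈ kernelRel π := by
  induction hp using Submonoid.closure_induction with
  | mem p hp =>
    rcases hp with (⟨a, rfl⟩ | ⟨a, y, hy, rfl⟩) | ⟨e, he, rfl⟩
    · exact fun y hy => weakInverse_mem_kernelRel π hy
    · intro u hu
      dsimp only at hu ⊢
      have h1 : u * y * (u * y) = u * y := by rw [← mul_assoc, hu]
      have h2 : y * u * (y * u) = y * u := by rw [mul_assoc, ← mul_assoc u, hu]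
      have h := mul_mem (mul_mem (idempotent_mem_kernelRel π h1) (letter_mem_kernelRel π a))
        (idempotent_mem_kernelRel π h2)
      have h3 : u * y * π a * (y * u) = u := by
        calc u * y * π a * (y * u) = u * (y * π a * y) * u := by simp only [mul_assoc]
          _ = u := by rw [hy, hu]
      simpa [h3] using h
    · intro y hy
      dsimp only at hy ⊢
      have h1 : y * e * (y * e) = y * e := by rw [← mul_assoc, hy]
      have h2 : e * y * (e * y) = e * y := by rw [mul_assoc, ← mul_assoc y, hy]
      have h := mul_mem (idempotent_mem_kernelRel π h1) (idempotent_mem_kernelRel π h2)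
      have h3 : y * e * (e * y) = y := by
        calc y * e * (e * y) = y * (e * e) * y := by simp only [mul_assoc]
          _ = y := by rw [he, hy]
      simpa [h3] using h
  | one =>
    intro y hy
    simpa using idempotent_mem_kernelRel π (e := y) (by simpa using hy)
  | mul p q _ _ ihp ihq =>
    intro y hy
    rw [Prod.fst_mul, ← mul_assoc] at hy
    have h1 := ihp (q.1 * y) (by
      calc q.1 * y * p.1 * (q.1 * y) = q.1 * (y * p.1 * q.1 * y) := by simp only [mul_assoc]
        _ = q.1 * y := by rw [hy])
    have h2 := ihq (y * p.1) (by
      calc y * p.1 * q.1 * (y * p.1) = y * p.1 * q.1 * y * p.1 := by simp only [mul_assoc]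
        _ = y * p.1 := by rw [hy])
    have h := mul_mem h2 h1
    have h3 : y * p.1 * (q.1 * y) = y := by rw [← mul_assoc, hy]
    simpa [h3] using h

theorem exists_pow_idempotent [Finite M] (x : M) : ∃ n, 0 < n ∧ x ^ n * x ^ n = x ^ n := by
  obtain ⟨i, j, hij, h⟩ : ∃ i j, i < j ∧ x ^ i = x ^ j := by
    obtain ⟨i, j, hne, h⟩ := Finite.exists_ne_map_eq_of_infinite fun n : ℕ => x ^ n
    rcases hne.lt_or_gt with hlt | hlt
    · exact ⟨i, j, hlt, h⟩
    · exact ⟨j, i, hlt, h.symm⟩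
  obtain ⟨d, hd, rfl⟩ : ∃ d, 0 < d ∧ j = i + d := ⟨j - i, by omega, by omega⟩
  have hstep (m : ℕ) (hm : i ≤ m) (c : ℕ) : x ^ (m + c * d) = x ^ m := by
    induction c with
    | zero => simp
    | succ c ih =>
      rw [← ih]
      obtain ⟨t, rfl⟩ : ∃ t, m = i + t := ⟨m - i, by omega⟩
      rw [show i + t + (c + 1) * d = (i + d) + (t + c * d) by ring, pow_add, ← h, ← pow_add,
        add_assoc]
  refine ⟨(i + 1) * d, by positivity, ?_⟩
  rw [← pow_add]
  exact hstep _ (by nlinarith) _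

/-- The labels of the `kernelRel` transitions from `p` to `q`. -/
def transitions (p q : M) : Set (FreeGroup (Fin k)) :=
  {g | ∃ x, (x, g) ∈ kernelRel π ∧ p * x = q}

theorem mul_mem_transitions {p q r : M} {g h : FreeGroup (Fin k)}
    (hg : g ∈ transitions π p q) (hh : h ∈ transitions π q r) : g * h ∈ transitions π p r := by
  obtain ⟨x, hx, rfl⟩ := hg
  obtain ⟨y, hy, rfl⟩ := hh
  exact ⟨x * y, mul_mem hx hy, (mul_assoc _ _ _).symm⟩

/-- The loops at `p` form a subgroup. -/
def loops [Finite M] (p : M) : Subgroup (FreeGroup (Fin k)) where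
  carrier := transitions π p p
  mul_mem' := mul_mem_transitions π
  one_mem' := ⟨1, one_mem _, mul_one p⟩
  inv_mem' := by
    rintro g ⟨x, hx, hp⟩
    obtain ⟨n, hn, he⟩ := exists_pow_idempotent x
    have hpow (m : ℕ) : p * x ^ m = p := by
      induction m with
      | zero => simp
      | succ m ih => rw [pow_succ', ← mul_assoc, hp, ih]
    refine ⟨x ^ (2 * n - 1), inv_mem_kernelRel π hx _ ?_, hpow _⟩
    have h4 : 2 * n - 1 + 1 + (2 * n - 1) = n + n + (2 * n - 1) := by omega
    have h2 : n + (2 * n - 1) = n + n + (n - 1) := by omega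
    have h1 : n + (n - 1) = 2 * n - 1 := by omega
    dsimp only
    rw [← pow_succ, ← pow_add, h4, pow_add, pow_add, he, ← pow_add, h2, pow_add, pow_add, he,
      ← pow_add, h1]

/-- Kleene's algorithm, with the star replaced by the generated subgroup. -/
theorem exists_productUnion_of_finset [Finite M] (T : Finset M) :
    ∃ C : M → M → Set (FreeGroup (Fin k)),
      (∀ p q, ProductUnion (C p q)) ∧ (∀ p q, C p q ⊆ transitions π p q) ∧
      (∀ p, 1 ∈ C p p) ∧ (∀ p a, FreeGroup.of a ∈ C p (p * π a)) ∧
      ∀ s ∈ T, ∀ p q, C p s * C s q ⊆ C p q := by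
  classical
  induction T using Finset.induction_on with
  | empty =>
    refine ⟨fun p q => {g | p = q ∧ g = 1} ∪ {g | ∃ a, p * π a = q ∧ g = FreeGroup.of a},
      fun p q => .of_finite ?_, fun p q => ?_, fun p => .inl ⟨rfl, rfl⟩,
      fun p a => .inr ⟨a, rfl, rfl⟩, by simp⟩
    · refine ((Set.finite_singleton 1).subset fun g hg => hg.2).union
        ((Set.finite_range FreeGroup.of).subset ?_)
      rintro _ ⟨a, -, rfl⟩
      exact ⟨a, rfl⟩
    · rintro _ (⟨rfl, rfl⟩ | ⟨a, rfl, rfl⟩)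
      · exact ⟨1, one_mem _, mul_one p⟩
      · exact ⟨_, letter_mem_kernelRel π a, rfl⟩
  | insert r T _ ih =>
    obtain ⟨C, hC, hsub, hone, hletter, hmul⟩ := ih
    let K : Subgroup (FreeGroup (Fin k)) := Subgroup.closure (C r r)
    have hK : K ≤ loops π r := (Subgroup.closure_le _).2 (hsub r r)
    refine ⟨fun p q => C p q ∪ C p r * (K : Set _) * C r q,
      fun p q => (hC p q).sup (((hC p r).mul (.subgroup (hC r r).closure_fg)).mul (hC r q)),
      fun p q => ?_, fun p => .inl (hone p), fun p a => .inl (hletter p a), fun s hs p q => ?_⟩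
    · rintro _ (hg | ⟨_, ⟨a, ha, b, hb, rfl⟩, c, hc, rfl⟩)
      · exact hsub p q hg
      · exact mul_mem_transitions π
          (mul_mem_transitions π (hsub _ _ ha) (hK hb)) (hsub _ _ hc)
    · have mk {p q : M} {a b c : FreeGroup (Fin k)} (ha : a ∈ C p r) (hb : b ∈ K)
          (hc : c ∈ C r q) : a * b * c ∈ C p q ∪ C p r * (K : Set _) * C r q :=
        .inr (Set.mul_mem_mul (Set.mul_mem_mul ha hb) hc)
      have hC_K {b : FreeGroup (Fin k)} (hb : b ∈ C r r) : b ∈ K := Subgroup.subset_closure hb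
      rcases Finset.mem_insert.1 hs with rfl | hs
      · rintro _ ⟨_, hx | ⟨_, ⟨a, ha, b, hb, rfl⟩, c, hc, rfl⟩, _,
          hy | ⟨_, ⟨a', ha', b', hb', rfl⟩, c', hc', rfl⟩, rfl⟩
        · simpa using mk hx (one_mem K) hy
        · simpa [mul_assoc] using mk hx (mul_mem (hC_K ha') hb') hc'
        · simpa [mul_assoc] using mk ha (mul_mem hb (hC_K hc)) hy
        · simpa [mul_assoc] using
            mk ha (mul_mem (mul_mem hb (hC_K hc)) (mul_mem (hC_K ha') hb')) hc'
      · have hm {p q : M} {x y : FreeGroup (Fin k)} (hx : x ∈ C p s) (hy : y ∈ C s q) :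
            x * y ∈ C p q := hmul s hs p q (Set.mul_mem_mul hx hy)
        rintro _ ⟨_, hx | ⟨_, ⟨a, ha, b, hb, rfl⟩, c, hc, rfl⟩, _,
          hy | ⟨_, ⟨a', ha', b', hb', rfl⟩, c', hc', rfl⟩, rfl⟩
        · exact .inl (hm hx hy)
        · simpa [mul_assoc] using mk (hm hx ha') hb' hc'
        · simpa [mul_assoc] using mk ha hb (hm hc hy)
        · simpa [mul_assoc] using mk ha (mul_mem hb (mul_mem (hC_K (hm hc ha')) hb')) hc'

/-- The words over the alphabet, with their values in `M` and in the free group. -/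
def wordRel : Submonoid (M × FreeGroup (Fin k)) :=
  Submonoid.closure {p | ∃ a, p = (π a, FreeGroup.of a)}

/-- If `1` lies in the profinite closure of the words with value `m`, then `(m, 1)` belongs to
`kernelRel`. -/
theorem mem_kernelRel_of_closure [Finite M]
    (hF : ∀ (n : ℕ) (H : Fin n → Subgroup (FreeGroup (Fin k))), (∀ i, (H i).FG) →
      ∀ g, g ∉ setwiseProd (fun i => (H i : Set (FreeGroup (Fin k)))) →
        ∃ Q : BGrp, Finite Q.carrier ∧ ∃ φ : FreeGroup (Fin k) →* Q.carrier,
            φ g ∉ setwiseProd (fun i => φ '' (H i : Set (FreeGroup (Fin k)))))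
    (m : M)
    (hm : ∀ Q : BGrp, Finite Q.carrier → ∀ φ : FreeGroup (Fin k) →* Q.carrier,
      ∃ f, (m, f) ∈ wordRel π ∧ φ f = 1) :
    (m, 1) ∈ kernelRel π := by
  cases nonempty_fintype M
  obtain ⟨C, hC, hsub, hone, hletter, hmul⟩ := exists_productUnion_of_finset π Finset.univ
  have hword (p : M × FreeGroup (Fin k)) (hp : p ∈ wordRel π) : ∀ q, p.2 ∈ C q (q * p.1) := by
    induction hp using Submonoid.closure_induction with
    | mem p hp =>
      obtain ⟨a, rfl⟩ := hp
      exact fun q => hletter q a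
    | one => simpa using hone
    | mul x y _ _ ihx ihy =>
      intro q
      rw [Prod.fst_mul, Prod.snd_mul, ← mul_assoc]
      exact hmul _ (Finset.mem_univ _) _ _ (Set.mul_mem_mul (ihx q) (ihy _))
  have h1 : (1 : FreeGroup (Fin k)) ∈ C 1 m := by
    by_contra hnot
    obtain ⟨Q, hQ, φ, hφ⟩ := (hC 1 m).profinitelyClosed hF 1 hnot
    obtain ⟨f, hf, hf1⟩ := hm Q hQ φ
    exact hφ ⟨f, by simpa using hword _ hf 1, by simp [hf1]⟩
  obtain ⟨x, hx, hxm⟩ := hsub 1 m h1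
  rw [one_mul] at hxm
  exact hxm ▸ hx

/-- The elements of `M` that may label a letter of the free group: `π a` for `a` and the weak
inverses of `π a` for `a⁻¹`. -/
def letterSet (c : Fin k × Bool) : Set M :=
  {x | if c.2 then x = π c.1 else x * π c.1 * x = x}

/-- `D X₁ D X₂ ⋯ Xₙ D`, where `Xᵢ` is the set of labels of the `i`-th letter. -/
def interleave (D : Submonoid M) : List (Fin k × Bool) → Set M
  | [] => D
  | c :: L => (D : Set M) * letterSet π c * interleave D L

variable {π} {D : Submonoid M}

theorem mul_mem_interleave {L : List (Fin k × Bool)} {d x : M} (hd : d ∈ D)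
    (hx : x ∈ interleave π D L) : d * x ∈ interleave π D L := by
  cases L with
  | nil => exact mul_mem hd hx
  | cons c L =>
    obtain ⟨_, ⟨d', hd', y, hy, rfl⟩, z, hz, rfl⟩ := hx
    exact ⟨_, ⟨d * d', mul_mem hd hd', y, hy, rfl⟩, z, hz, by simp only [mul_assoc]⟩

theorem append_mem_interleave {L L' : List (Fin k × Bool)} {x y : M}
    (hx : x ∈ interleave π D L) (hy : y ∈ interleave π D L') :
    x * y ∈ interleave π D (L ++ L') := by
  induction L generalizing x with
  | nil => exact mul_mem_interleave hx hy
  | cons c L ih =>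
    obtain ⟨w, hw, z, hz, rfl⟩ := hx
    exact ⟨w, hw, z * y, ih hz, by simp only [mul_assoc]⟩

theorem interleave_step (hconj : ∀ s t : M, s * t * s = s → ∀ x ∈ D, s * x * t ∈ D ∧ t * x * s ∈ D)
    {L L' : List (Fin k × Bool)} (h : FreeGroup.Red.Step L L') :
    interleave π D L ⊆ interleave π D L' := by
  obtain @⟨L₁, L₂, a, b⟩ := h
  induction L₁ with
  | nil =>
    rintro _ ⟨_, ⟨d, hd, x, hx, rfl⟩, _, ⟨_, ⟨d', hd', y, hy, rfl⟩, z, hz, rfl⟩, rfl⟩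
    have hxy : x * d' * y ∈ D := by
      cases b
      · simp only [letterSet, Bool.false_eq_true, Bool.not_false, if_true, if_false,
          Set.mem_ofPred_eq] at hx hy
        exact hy ▸ (hconj x (π a) hx d' hd').1
      · simp only [letterSet, Bool.false_eq_true, Bool.not_true, if_true, if_false,
          Set.mem_ofPred_eq] at hx hy
        exact hx ▸ (hconj y (π a) hy d' hd').2
    simpa [mul_assoc] using mul_mem_interleave (mul_mem hd hxy) hz
  | cons c L ih =>
    exact Set.mul_subset_mul_left ih

theorem interleave_red (hconj : ∀ s t : M, s * t * s = s → ∀ x ∈ D, s * x * t ∈ D ∧ t * x * s ∈ D)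
    {L L' : List (Fin k × Bool)} (h : FreeGroup.Red L L') :
    interleave π D L ⊆ interleave π D L' := by
  induction h with
  | refl => exact subset_rfl
  | tail _ h ih => exact ih.trans (interleave_step hconj h)

theorem mem_of_mem_kernelRel (hidem : ∀ e : M, e * e = e → e ∈ D)
    (hconj : ∀ s t : M, s * t * s = s → ∀ x ∈ D, s * x * t ∈ D ∧ t * x * s ∈ D)
    {m : M} (hm : (m, 1) ∈ kernelRel π) : m ∈ D := by
  have key (p : M × FreeGroup (Fin k)) (hp : p ∈ kernelRel π) :
      ∃ L, FreeGroup.mk L = p.2 ∧ p.1 ∈ interleave π D L := by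
    induction hp using Submonoid.closure_induction with
    | mem p hp =>
      rcases hp with (⟨a, rfl⟩ | ⟨a, y, hy, rfl⟩) | ⟨e, he, rfl⟩
      · exact ⟨[(a, true)], rfl,
          ⟨_, ⟨1, one_mem D, π a, by simp [letterSet], rfl⟩, 1, one_mem D, by simp⟩⟩
      · exact ⟨[(a, false)], rfl,
          ⟨_, ⟨1, one_mem D, y, by simpa [letterSet] using hy, rfl⟩, 1, one_mem D, by simp⟩⟩
      · exact ⟨[], rfl, hidem e he⟩
    | one => exact ⟨[], rfl, one_mem D⟩
    | mul x y _ _ ihx ihy =>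
      obtain ⟨L, hL, hx⟩ := ihx
      obtain ⟨L', hL', hy⟩ := ihy
      exact ⟨L ++ L', by rw [← FreeGroup.mul_mk, hL, hL']; rfl, append_mem_interleave hx hy⟩
  obtain ⟨L, hL, hmL⟩ := key _ hm
  obtain ⟨L', h1, h2⟩ := FreeGroup.Red.exact.1 (hL.trans FreeGroup.one_eq_mk)
  rw [FreeGroup.Red.nil_iff.1 h2] at h1
  exact interleave_red hconj h1 hmL

end Relation

/-! ### Adjoining an identity -/

section WithOne

variable {S : Type} [Semigroup S]

theorem idempotent_mem_dSub {e : S} (he : e * e = e) : e ∈ DSub S :=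
  Subsemigroup.mem_sInf.2 fun _ hT => hT.1 e he

theorem weakConjClosed_dSub : WeakConjClosed (DSub S) := fun s t hst x hx =>
  ⟨Subsemigroup.mem_sInf.2 fun _ hT => (hT.2 s t hst x (Subsemigroup.mem_sInf.1 hx _ hT)).1,
    Subsemigroup.mem_sInf.2 fun _ hT => (hT.2 s t hst x (Subsemigroup.mem_sInf.1 hx _ hT)).2⟩

variable (S) in
/-- The submonoid `D(S) ∪ {1}` of `S¹`. -/
def dSubOne : Submonoid (WithOne S) where
  carrier := {x | ∀ s : S, x = s → s ∈ DSub S}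
  one_mem' := fun s h => absurd h.symm WithOne.coe_ne_one
  mul_mem' := by
    intro x y hx hy
    cases x with
    | one => simpa using hy
    | coe x =>
      cases y with
      | one => simpa using hx
      | coe y =>
        intro s hs
        rw [← WithOne.coe_mul, WithOne.coe_inj] at hs
        exact hs ▸ mul_mem (hx x rfl) (hy y rfl)

theorem coe_mem_dSubOne {s : S} : (s : WithOne S) ∈ dSubOne S ↔ s ∈ DSub S :=
  ⟨fun h => h s rfl, fun h _ ht => WithOne.coe_inj.1 ht ▸ h⟩

theorem idempotent_mem_dSubOne (e : WithOne S) (he : e * e = e) : e ∈ dSubOne S := by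
  cases e with
  | one => exact one_mem _
  | coe e =>
    rw [← WithOne.coe_mul, WithOne.coe_inj] at he
    exact coe_mem_dSubOne.2 (idempotent_mem_dSub he)

theorem weakConj_dSubOne (s t : WithOne S) (hst : s * t * s = s) (x : WithOne S)
    (hx : x ∈ dSubOne S) : s * x * t ∈ dSubOne S ∧ t * x * s ∈ dSubOne S := by
  cases s with
  | one =>
    obtain rfl : t = 1 := by simpa using hst
    simpa using hx
  | coe s =>
    cases t with
    | one =>
      have hs := idempotent_mem_dSubOne (s : WithOne S) (by simpa using hst)
      simpa using And.intro (mul_mem hs hx) (mul_mem hx hs)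
    | coe t =>
      cases x with
      | one =>
        simp only [mul_one]
        refine ⟨idempotent_mem_dSubOne _ ?_, idempotent_mem_dSubOne _ ?_⟩
        · rw [← mul_assoc, hst]
        · rw [mul_assoc, ← mul_assoc (s : WithOne S), hst]
      | coe x =>
        simp only [← WithOne.coe_mul, WithOne.coe_inj, coe_mem_dSubOne] at hst hx ⊢
        exact weakConjClosed_dSub s t hst x hx

end WithOne

end PinReutenauer

/-- Pin–Reutenauer reduction: if products of finitely generated subgroups of
finitely generated free groups are closed in the profinite topology (the Ribes–Zalesskii
property), then for every finite semigroup `S` one has `K(S) ⊆ D(S)`. -/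
theorem pin_reutenauer_reduction
    (hRZ : ∀ (k n : ℕ) (H : Fin n → Subgroup (FreeGroup (Fin k))),
      (∀ i, (H i).FG) →
      ∀ g : FreeGroup (Fin k),
        g ∉ setwiseProd (fun i => (H i : Set (FreeGroup (Fin k)))) →
        ∃ Q : BGrp, Finite Q.carrier ∧
          ∃ φ : FreeGroup (Fin k) →* Q.carrier,
            φ g ∉ setwiseProd (fun i => φ '' (H i : Set (FreeGroup (Fin k))))) :
    ∀ (S : Type) [Semigroup S] [Finite S] (s : S), IsTypeII s → s ∈ DSub S := by
  intro S _ _ s hs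
  obtain ⟨k, ⟨e⟩⟩ := Finite.exists_equiv_fin S
  let π : Fin k → WithOne S := fun a => (e.symm a : S)
  have : Finite (WithOne S) := inferInstanceAs (Finite (Option S))
  refine PinReutenauer.coe_mem_dSubOne.1 (PinReutenauer.mem_of_mem_kernelRel (π := π)
    PinReutenauer.idempotent_mem_dSubOne PinReutenauer.weakConj_dSubOne
    (PinReutenauer.mem_kernelRel_of_closure π (hRZ k) _ fun Q hQ φ => ?_))
  let R : Subsemigroup (S × Q.carrier) :=
    { carrier := {p | ∃ f, ((p.1 : WithOne S), f) ∈ PinReutenauer.wordRel π ∧ φ f = p.2}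
      mul_mem' := by
        rintro p q ⟨f, hf, hfp⟩ ⟨g, hg, hgq⟩
        exact ⟨f * g, by simpa using mul_mem hf hg, by simp [hfp, hgq]⟩ }
  refine hs Q.carrier R fun x => ⟨φ (FreeGroup.of (e x)), FreeGroup.of (e x), ?_, rfl⟩
  exact Submonoid.subset_closure ⟨e x, by simp [π]⟩
end

section
/- (Ash's theorem; the type II conjecture) For every finite semigroup S, the group kernel equals the weak conjugation closure of the idempotents: K(S) = D(S). That is, an element s ∈ S satisfies (s, 1_G) ∈ R for every finite group G and every relational morphism R from S to G if and only if s belongs to the smallest subsemigroup of S containing all idempotents and closed under weak conjugation. -/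
/-- `WalkLabel E x g y`: some walk from `x` to `y` in the `A`-labelled graph `E`, which may
traverse edges in both directions, has label `g` in the free group. -/
inductive WalkLabel {V A : Type} (E : V → A → V → Prop) (x : V) : FreeGroup A → V → Prop
  | refl : WalkLabel E x 1 x
  | forward {g y a z} : WalkLabel E x g y → E y a z → WalkLabel E x (g * FreeGroup.of a) z
  | backward {g y a z} : WalkLabel E x g z → E y a z → WalkLabel E x (g * (FreeGroup.of a)⁻¹) y

namespace WalkLabel

variable {V A : Type} {E : V → A → V → Prop}

theorem trans {x y z : V} {g h : FreeGroup A} (hg : WalkLabel E x g y)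
    (hh : WalkLabel E y h z) : WalkLabel E x (g * h) z := by
  induction hh with
  | refl => simpa using hg
  | forward _ he ih => rw [← mul_assoc]; exact ih.forward he
  | backward _ he ih => rw [← mul_assoc]; exact ih.backward he

theorem edge {x y : V} {a : A} (h : E x a y) : WalkLabel E x (FreeGroup.of a) y := by
  simpa using (refl (E := E) (x := x)).forward h

theorem edge_inv {x y : V} {a : A} (h : E x a y) : WalkLabel E y (FreeGroup.of a)⁻¹ x := by
  simpa using (refl (E := E) (x := y)).backward h

theorem symm {x y : V} {g : FreeGroup A} (hg : WalkLabel E x g y) : WalkLabel E y g⁻¹ x := by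
  induction hg with
  | refl => simpa using refl
  | forward _ he ih => rw [mul_inv_rev]; exact (edge_inv he).trans ih
  | backward _ he ih => rw [mul_inv_rev, inv_inv]; exact (edge he).trans ih

end WalkLabel

/-- The product of the sets of labels of walks between the pairs of vertices in a list. -/
def ProdLabel {V A : Type} (E : V → A → V → Prop) : List (V × V) → FreeGroup A → Prop
  | [], g => g = 1
  | p :: l, g => ∃ a b, WalkLabel E p.1 a p.2 ∧ ProdLabel E l b ∧ g = a * b

theorem prodLabel_append {V A : Type} {E : V → A → V → Prop} (l m : List (V × V))
    (g : FreeGroup A) :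
    ProdLabel E (l ++ m) g ↔ ∃ a b, ProdLabel E l a ∧ ProdLabel E m b ∧ g = a * b := by
  induction l generalizing g with
  | nil => simp [ProdLabel]
  | cons p l ih =>
    simp only [List.cons_append, ProdLabel, ih]
    constructor
    · rintro ⟨a, _, ha, ⟨b, c, hb, hc, rfl⟩, rfl⟩
      exact ⟨a * b, c, ⟨a, b, ha, hb, rfl⟩, hc, by group⟩
    · rintro ⟨_, c, ⟨a, b, ha, hb, rfl⟩, hc, rfl⟩
      exact ⟨a, b * c, ha, ⟨b, c, hb, hc, rfl⟩, by group⟩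

theorem prodLabel_singleton {V A : Type} {E : V → A → V → Prop} (p : V × V)
    (g : FreeGroup A) : ProdLabel E [p] g ↔ WalkLabel E p.1 g p.2 := by
  simp [ProdLabel]

/-- The homomorphism `π` detects whether `1` lies in a product of at most `n` sets of labels. -/
def Separates {V A G : Type} [Group G] (E : V → A → V → Prop) (π : FreeGroup A →* G)
    (n : ℕ) : Prop :=
  ∀ l : List (V × V), l.length ≤ n → ∀ g, ProdLabel E l g → π g = 1 → ProdLabel E l 1

theorem Separates.walkLabel_one {V A G : Type} [Group G] {E : V → A → V → Prop}
    {π : FreeGroup A →* G} {n : ℕ} (h : Separates E π n) (hn : 1 ≤ n) {x y : V}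
    {g : FreeGroup A} (hg : WalkLabel E x g y) (h1 : π g = 1) : WalkLabel E x 1 y := by
  have := h [(x, y)] (by simpa using hn) g ((prodLabel_singleton _ _).2 hg) h1
  exact (prodLabel_singleton _ _).1 this

theorem Separates.walkLabel_transfer {V A G : Type} [Group G] {E : V → A → V → Prop}
    {π : FreeGroup A →* G} {n : ℕ} (h : Separates E π n) (hn : 1 ≤ n) {x y z : V}
    {g k : FreeGroup A} (hg : WalkLabel E x g y) (hk : WalkLabel E x k z) (hgk : π g = π k) :
    WalkLabel E x g z := by
  have := h.walkLabel_one hn (hg.symm.trans hk) (by simp [hgk])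
  simpa using hg.trans this

theorem exists_perm_extend {Q : Type} [Finite Q] (r : Q → Q → Prop)
    (hf : ∀ x y z, r x y → r x z → y = z) (hi : ∀ x y z, r x z → r y z → x = y) :
    ∃ σ : Equiv.Perm Q, ∀ x y, r x y → σ x = y := by
  classical
  cases nonempty_fintype Q
  let f : Q → Q := fun x => if h : ∃ y, r x y then h.choose else x
  have hfx : ∀ x y, r x y → f x = y := fun x y h => by
    have h' : ∃ y, r x y := ⟨y, h⟩
    simp only [f, dif_pos h']
    exact hf _ _ _ h'.choose_spec h
  obtain ⟨g, hg⟩ := Finset.exists_equiv_extend_of_card_eq (α := Q) (β := Q)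
    (t := Finset.univ) rfl (s := Finset.univ.filter fun x => ∃ y, r x y) (f := f)
    (Finset.subset_univ _) (by
      intro x hx y hy hxy
      simp only [Finset.coe_filter, Finset.mem_univ, true_and, Set.mem_ofPred_eq] at hx hy
      obtain ⟨x', hx⟩ := hx
      obtain ⟨y', hy⟩ := hy
      rw [hfx _ _ hx, hfx _ _ hy] at hxy
      subst hxy
      exact hi _ _ _ hx hy)
  refine ⟨g.trans (Equiv.subtypeUnivEquiv fun x => Finset.mem_univ x), fun x y h => ?_⟩
  rw [← hfx x y h]
  exact hg x (by simpa using ⟨y, h⟩)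

open MulOpposite in
theorem exists_separates_one {V A : Type} [Finite V] (E : V → A → V → Prop) :
    ∃ (G : Type) (_ : Group G) (_ : Finite G) (π : FreeGroup A →* G), Separates E π 1 := by
  let s : Setoid V :=
    { r := fun x y => WalkLabel E x 1 y
      iseqv := ⟨fun _ => .refl, fun h => by simpa using h.symm,
        fun h k => by simpa using h.trans k⟩ }
  have hperm : ∀ a : A, ∃ σ : Equiv.Perm (Quotient s),
      ∀ x y, E x a y → σ (Quotient.mk s x) = Quotient.mk s y := by
    intro a
    obtain ⟨σ, hσ⟩ := exists_perm_extend
      (fun p q : Quotient s => ∃ x y, E x a y ∧ p = Quotient.mk s x ∧ q = Quotient.mk s y) (by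
        rintro _ _ _ ⟨x, y, h, rfl, rfl⟩ ⟨x', y', h', hx, rfl⟩
        have hx : WalkLabel E x 1 x' := Quotient.exact hx
        refine Quotient.sound (show WalkLabel E y 1 y' from ?_)
        simpa using ((WalkLabel.edge_inv h).trans hx).trans (WalkLabel.edge h')) (by
        rintro _ _ _ ⟨x, y, h, rfl, rfl⟩ ⟨x', y', h', rfl, hy⟩
        have hy : WalkLabel E y 1 y' := Quotient.exact hy
        refine Quotient.sound (show WalkLabel E x 1 x' from ?_)
        simpa using ((WalkLabel.edge h).trans hy).trans (WalkLabel.edge_inv h'))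
    exact ⟨σ, fun x y h => hσ _ _ ⟨x, y, h, rfl, rfl⟩⟩
  choose σ hσ using hperm
  let π : FreeGroup A →* (Equiv.Perm (Quotient s))ᵐᵒᵖ := FreeGroup.lift fun a => op (σ a)
  have key : ∀ x g y, WalkLabel E x g y →
      (π g).unop (Quotient.mk s x) = Quotient.mk s y := by
    intro x g y h
    induction h with
    | refl => simp
    | forward _ he ih => simp [π, unop_mul, ← hσ _ _ _ he, ← ih]
    | backward _ he ih =>
      simp only [map_mul, map_inv, unop_mul, unop_inv, Equiv.Perm.mul_apply, ih]
      rw [Equiv.Perm.inv_eq_iff_eq]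
      simp [π, hσ _ _ _ he]
  refine ⟨_, inferInstance, .of_equiv _ opEquiv, π, fun l hl g hg h1 => ?_⟩
  match l, hl with
  | [], _ => rfl
  | [p], _ =>
    rw [prodLabel_singleton] at hg ⊢
    have := key _ _ _ hg
    rw [h1] at this
    exact Quotient.exact this

section Cover

variable {A G : Type} [Group G]

open MulOpposite in
/-- The right action of the free group on the two-fold cover of the Cayley graph of `G`
described by the `ZMod 2`-valued cochain `χ`. -/
def coverHom (π : FreeGroup A →* G) (χ : G × A → ZMod 2) :
    FreeGroup A →* (Equiv.Perm (G × ZMod 2))ᵐᵒᵖ :=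
  FreeGroup.lift fun a => op
    { toFun := fun p => (p.1 * π (.of a), p.2 + χ (p.1, a))
      invFun := fun p => (p.1 * (π (.of a))⁻¹, p.2 - χ (p.1 * (π (.of a))⁻¹, a))
      left_inv := fun p => by simp
      right_inv := fun p => by simp }

variable (π : FreeGroup A →* G) (χ : G × A → ZMod 2)

theorem coverHom_mul (g h : FreeGroup A) (p : G × ZMod 2) :
    (coverHom π χ (g * h)).unop p = (coverHom π χ h).unop ((coverHom π χ g).unop p) := by
  simp

theorem coverHom_of (a : A) (p : G × ZMod 2) :
    (coverHom π χ (.of a)).unop p = (p.1 * π (.of a), p.2 + χ (p.1, a)) := by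
  simp [coverHom]

theorem coverHom_of_inv (a : A) (p : G × ZMod 2) :
    (coverHom π χ (.of a)⁻¹).unop p =
      (p.1 * (π (.of a))⁻¹, p.2 - χ (p.1 * (π (.of a))⁻¹, a)) := by
  rw [map_inv, MulOpposite.unop_inv, Equiv.Perm.inv_eq_iff_eq, coverHom_of]
  simp

theorem coverHom_fst (g : FreeGroup A) (p : G × ZMod 2) :
    ((coverHom π χ g).unop p).1 = p.1 * π g := by
  induction g using FreeGroup.induction_on generalizing p with
  | C1 => simp
  | of a => simp [coverHom_of]
  | inv_of a _ => rw [coverHom_of_inv, map_inv]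
  | mul g h hg hh => rw [coverHom_mul, hh, hg, map_mul, mul_assoc]

theorem coverHom_walkLabel {V : Type} {E : V → A → V → Prop} (c : G → ZMod 2) {x y : V}
    {g : FreeGroup A} (hg : WalkLabel E x g y) (h : G) (t : ZMod 2)
    (hc : ∀ γ z a z', WalkLabel E x γ z → E z a z' →
      χ (h * π γ, a) = c (h * π γ * π (.of a)) - c (h * π γ)) :
    (coverHom π χ g).unop (h, t) = (h * π g, t + (c (h * π g) - c h)) := by
  induction hg with
  | refl => simp
  | forward hw he ih =>
    rw [coverHom_mul, ih, coverHom_of]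
    simp only [hc _ _ _ _ hw he, map_mul, mul_assoc, Prod.mk.injEq, true_and]
    ring
  | @backward g y a z hw he ih =>
    have := hc _ _ _ _ (hw.backward he) he
    rw [coverHom_mul, ih, coverHom_of_inv]
    simp only [map_mul, map_inv, mul_assoc, inv_mul_cancel, mul_one] at this
    simp only [this, map_mul, map_inv, mul_assoc, Prod.mk.injEq, true_and]
    ring

theorem coverHom_prodLabel {V : Type} {E : V → A → V → Prop} (l : List (V × V))
    {g : FreeGroup A} (hg : ProdLabel E l g) (h : G) (t : ZMod 2)
    (hχ : ∀ l₁ p l₂ a b d, l = l₁ ++ p :: l₂ → g = a * b * d → ProdLabel E l₁ a →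
      WalkLabel E p.1 b p.2 → ProdLabel E l₂ d →
      ∀ γ z k z', WalkLabel E p.1 γ z → E z k z' → χ (h * π a * π γ, k) = 0) :
    (coverHom π χ g).unop (h, t) = (h * π g, t) := by
  induction l generalizing g h with
  | nil =>
    obtain rfl : g = 1 := hg
    simp
  | cons p l ih =>
    obtain ⟨a, b, ha, hb, rfl⟩ := hg
    rw [coverHom_mul, coverHom_walkLabel π χ (fun _ => 0) ha h t]
    · rw [sub_zero, add_zero, ih hb]
      · simp [mul_assoc]
      · rintro l₁ q l₂ a' b' d rfl rfl ha' hb' hd γ z k z' hγ he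
        have := hχ (p :: l₁) q l₂ (a * a') b' d rfl (by group) ⟨a, a', ha, ha', rfl⟩ hb' hd
          γ z k z' hγ he
        simpa [mul_assoc] using this
    · intro γ z k z' hγ he
      simpa using hχ [] p l 1 a b rfl (by group) rfl ha hb γ z k z' hγ he

end Cover

/-- The product over all `ZMod 2`-valued cochains of the actions `coverHom`. -/
def universalCover {A G : Type} [Group G] (π : FreeGroup A →* G) :
    FreeGroup A →* ((G × A → ZMod 2) → (Equiv.Perm (G × ZMod 2))ᵐᵒᵖ) :=
  MonoidHom.pi (coverHom π)

theorem coverHom_of_universalCover_eq_one {A G : Type} [Group G] {π : FreeGroup A →* G}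
    {g : FreeGroup A} (hg : universalCover π g = 1) (χ : G × A → ZMod 2) :
    coverHom π χ g = 1 := congrFun hg χ

theorem eq_one_of_universalCover_eq_one {A G : Type} [Group G] {π : FreeGroup A →* G}
    {g : FreeGroup A} (hg : universalCover π g = 1) : π g = 1 := by
  have := coverHom_fst π 0 g (1, 0)
  rw [coverHom_of_universalCover_eq_one hg] at this
  simpa using this.symm

theorem Separates.prodLabel_one_of_meet {V A G : Type} [Group G] {E : V → A → V → Prop}
    {π : FreeGroup A →* G} {n : ℕ} (hπ : Separates E π n) {p q i : V × V}
    {l m : List (V × V)} (hl : l.length + 2 ≤ n) (hm : m.length + 2 ≤ n)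
    {g a b d k γ θ : FreeGroup A} {u z w : V} (hg : WalkLabel E p.1 g p.2)
    (ha : ProdLabel E l a) (hb : WalkLabel E i.1 b i.2) (hd : ProdLabel E m d)
    (hk : WalkLabel E q.1 k q.2) (h1 : π (g * (a * b * d * k)) = 1)
    (hγ : WalkLabel E i.1 γ u) (hz : WalkLabel E p.1 θ z) (hw : WalkLabel E q.2 θ w)
    (hθ : π θ = π (g * a * γ)) : ProdLabel E (p :: (l ++ i :: m ++ [q])) 1 := by
  have h₁ : ProdLabel E ((z, p.2) :: (l ++ [(i.1, u)])) 1 := by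
    refine hπ _ (by simp; omega) (θ⁻¹ * g * (a * γ)) ?_ ?_
    · exact ⟨_, _, hz.symm.trans hg, (prodLabel_append _ _ _).2
        ⟨a, γ, ha, (prodLabel_singleton _ _).2 hγ, rfl⟩, rfl⟩
    · simp only [map_mul, map_inv, hθ]
      group
  have h₂ : ProdLabel E ((u, i.2) :: (m ++ [(q.1, w)])) 1 := by
    refine hπ _ (by simp; omega) (γ⁻¹ * b * (d * (k * θ))) ?_ ?_
    · exact ⟨_, _, hγ.symm.trans hb, (prodLabel_append _ _ _).2
        ⟨d, _, hd, (prodLabel_singleton _ _).2 (hk.trans hw), rfl⟩, rfl⟩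
    · have : π (γ⁻¹ * b * (d * (k * θ))) =
          (π (g * a * γ))⁻¹ * π (g * (a * b * d * k)) * π (g * a * γ) := by
        simp only [map_mul, map_inv, hθ]
        group
      rw [this, h1]
      group
  obtain ⟨r, _, hr, hr₀, e₁⟩ := h₁
  obtain ⟨a', r', ha', hr', rfl⟩ := (prodLabel_append _ _ _).1 hr₀
  obtain ⟨s, _, hs, hs₀, e₂⟩ := h₂
  obtain ⟨d', s', hd', hs', rfl⟩ := (prodLabel_append _ _ _).1 hs₀
  rw [prodLabel_singleton] at hr' hs'
  refine ⟨θ * r, a' * (r' * s * d') * (s' * θ⁻¹), hz.trans hr,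
    (prodLabel_append _ _ _).2 ⟨_, _, (prodLabel_append _ _ _).2
      ⟨a', _, ha', ⟨_, d', hr'.trans hs, hd', rfl⟩, rfl⟩,
      (prodLabel_singleton _ _).2 (hs'.trans hw.symm), rfl⟩, ?_⟩
  calc (1 : FreeGroup A) = θ * 1 * 1 * θ⁻¹ := by group
    _ = θ * (r * (a' * r')) * (s * (d' * s')) * θ⁻¹ := by rw [← e₁, ← e₂]
    _ = _ := by group

theorem separates_universalCover {V A G : Type} [Group G] {E : V → A → V → Prop}
    {π : FreeGroup A →* G} {n : ℕ} (hn : 1 ≤ n) (hπ : Separates E π n) :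
    Separates E (universalCover π) (n + 1) := by
  classical
  intro l hl g hg h1
  have h1' := eq_one_of_universalCover_eq_one h1
  match l with
  | [] => rfl
  | p :: l =>
  obtain rfl | ⟨l, q, rfl⟩ := l.eq_nil_or_concat'
  · exact hπ _ (by simpa using hn) g hg h1'
  obtain ⟨g, _, hg, hr₀, rfl⟩ := hg
  obtain ⟨r, k, hr, hk, rfl⟩ := (prodLabel_append _ _ _).1 hr₀
  clear hr₀
  rw [prodLabel_singleton] at hk
  set U : Set G := {h | ∃ θ z w, π θ = h ∧ WalkLabel E p.1 θ z ∧ WalkLabel E q.2 θ w}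
  by_cases hmeet : ∃ l₁ i l₂ a b d γ u, l = l₁ ++ i :: l₂ ∧ r = a * b * d ∧
      ProdLabel E l₁ a ∧ WalkLabel E i.1 b i.2 ∧ ProdLabel E l₂ d ∧
      WalkLabel E i.1 γ u ∧ π (g * a * γ) ∈ U
  · obtain ⟨l₁, i, l₂, a, b, d, γ, u, rfl, rfl, ha, hb, hd, hγ, θ, z, w, hθ, hz, hw⟩ := hmeet
    simp only [List.length_cons, List.length_append, List.length_nil] at hl
    exact hπ.prodLabel_one_of_meet (by omega) (by omega) hg ha hb hd hk h1' hγ hz hw hθ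
  · have hgU : π g ∈ U := by
      by_contra hgU
      let c : G → ZMod 2 := fun h => if h ∈ U then 1 else 0
      let χ : G × A → ZMod 2 := fun e =>
        if ∃ γ z z', π γ = e.1 ∧ WalkLabel E p.1 γ z ∧ E z e.2 z' then
          c (e.1 * π (.of e.2)) - c e.1 else 0
      have hχ₁ := coverHom_walkLabel π χ c hg 1 0 (by
        intro γ z a z' hγ he
        simp only [one_mul, χ]
        exact if_pos ⟨γ, z, z', rfl, hγ, he⟩)
      have hχ₂ := fun t => coverHom_prodLabel π χ l hr (π g) t (by
        intro l₁ i l₂ a b d hl' hr' ha hb hd γ z e z' hγ he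
        have hs : π g * π a * π γ ∉ U := fun h =>
          hmeet ⟨l₁, i, l₂, a, b, d, γ, z, hl', hr', ha, hb, hd, hγ, by simpa using h⟩
        have ht : π g * π a * π γ * π (.of e) ∉ U := fun h =>
          hmeet ⟨l₁, i, l₂, a, b, d, _, z', hl', hr', ha, hb, hd, hγ.forward he,
            by simpa [mul_assoc] using h⟩
        simp [χ, c, hs, ht])
      have hχ₃ := fun t => coverHom_walkLabel π χ (fun _ => 0) hk (π g * π r) t (by
        intro γ z e z' hγ he
        rw [sub_zero]
        by_cases hK : ∃ γ' z z', π γ' = π g * π r * π γ ∧ WalkLabel E p.1 γ' z ∧ E z e z'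
        · obtain ⟨γ', y, y', hγ', hy, hyy'⟩ := hK
          have hq : WalkLabel E q.2 (k⁻¹ * γ) z := hk.symm.trans hγ
          have hqπ : π (k⁻¹ * γ) = π g * π r * π γ := by
            rw [map_mul, map_inv, inv_eq_of_mul_eq_one_left]
            simpa [mul_assoc] using h1'
          have hiff : π g * π r * π γ * π (.of e) ∈ U ↔ π g * π r * π γ ∈ U := by
            constructor
            · rintro ⟨θ, s, w, hθ, hs, hw⟩
              have hs' := hπ.walkLabel_transfer hn hs (hy.forward hyy')
                (by rw [hθ, map_mul, hγ'])
              have hw' := hπ.walkLabel_transfer hn hw (hq.forward he)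
                (by rw [hθ, map_mul, hqπ])
              exact ⟨_, _, _, by rw [map_mul, hθ, map_inv]; group, hs'.backward hyy',
                hw'.backward he⟩
            · rintro ⟨θ, s, w, hθ, hs, hw⟩
              have hs' := hπ.walkLabel_transfer hn hs hy (by rw [hθ, hγ'])
              have hw' := hπ.walkLabel_transfer hn hw hq (by rw [hθ, hqπ])
              exact ⟨_, _, _, by rw [map_mul, hθ], hs'.forward hyy', hw'.forward he⟩
          simp only [χ, c, hiff, sub_self, ite_self]
        · exact if_neg hK)
      have htot : (coverHom π χ (g * (r * k))).unop (1, 0) = (1, 0) := by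
        rw [coverHom_of_universalCover_eq_one h1]
        rfl
      have hone : (1 : G) ∈ U := ⟨1, _, _, map_one π, .refl, .refl⟩
      rw [coverHom_mul, coverHom_mul, hχ₁, one_mul, hχ₂, hχ₃] at htot
      simp [c, hgU, hone] at htot
    match l with
    | [] =>
      obtain ⟨θ, z, w, hθ, hz, hw⟩ := hgU
      obtain rfl : r = 1 := hr
      have hp := hπ.walkLabel_transfer hn hz hg hθ
      have hq := hπ.walkLabel_transfer hn hw hk.symm (by
        rw [hθ, map_inv]
        exact eq_inv_of_mul_eq_one_left (by simpa using h1'))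
      exact ⟨θ, θ⁻¹, hp, (prodLabel_singleton _ _).2 (by simpa using hq.symm), by group⟩
    | i :: l =>
      obtain ⟨b, d, hb, hd, rfl⟩ := hr
      exact absurd ⟨[], i, l, 1, b, d, 1, i.1, rfl, by group, rfl, hb, hd, .refl,
        by simpa using hgU⟩ hmeet

/-- A form of the Ribes–Zalesskii product theorem. -/
theorem exists_separates {V A : Type} [Finite V] [Finite A] (E : V → A → V → Prop) (n : ℕ) :
    ∃ (G : Type) (_ : Group G) (_ : Finite G) (π : FreeGroup A →* G),
      Separates E π (n + 1) := by
  induction n with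
  | zero => exact exists_separates_one E
  | succ n ih =>
    obtain ⟨G, _, _, π, hπ⟩ := ih
    have : Finite (Equiv.Perm (G × ZMod 2))ᵐᵒᵖ := .of_equiv _ MulOpposite.opEquiv
    exact ⟨_, inferInstance, inferInstance, _, separates_universalCover (by omega) hπ⟩

section ExtendedWords

variable {A M : Type} [Monoid M] (φ : A → M) (P : Submonoid M)

/-- The values in `M` of a signed letter: a positive letter is evaluated by `φ`, a negative one
by any weak inverse of that value. -/
def IsLetterValue : A × Bool → M → Prop
  | (a, true), u => u = φ a
  | (a, false), u => u * φ a * u = u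

/-- The values in `M` of a signed word, with elements of `P` inserted between the letters. -/
def IsWordValue : List (A × Bool) → M → Prop
  | [], m => m ∈ P
  | c :: L, m => ∃ d ∈ P, ∃ u v, IsLetterValue φ c u ∧ IsWordValue L v ∧ m = d * u * v

variable {φ P}

theorem IsWordValue.mul_left {L : List (A × Bool)} {d m : M} (hd : d ∈ P)
    (hm : IsWordValue φ P L m) : IsWordValue φ P L (d * m) := by
  cases L with
  | nil => exact mul_mem hd hm
  | cons c L =>
    obtain ⟨d', hd', u, v, hu, hv, rfl⟩ := hm
    exact ⟨d * d', mul_mem hd hd', u, v, hu, hv, by simp only [mul_assoc]⟩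

theorem isWordValue_append (L L' : List (A × Bool)) (m : M) :
    IsWordValue φ P (L ++ L') m ↔
      ∃ u v, IsWordValue φ P L u ∧ IsWordValue φ P L' v ∧ m = u * v := by
  induction L generalizing m with
  | nil =>
    constructor
    · exact fun h => ⟨1, m, one_mem P, h, by simp⟩
    · rintro ⟨u, v, hu, hv, rfl⟩
      exact hv.mul_left hu
  | cons c L ih =>
    simp only [List.cons_append, IsWordValue, ih]
    constructor
    · rintro ⟨d, hd, u, _, hu, ⟨v, w, hv, hw, rfl⟩, rfl⟩
      exact ⟨_, w, ⟨d, hd, u, v, hu, hv, rfl⟩, hw, by simp only [mul_assoc]⟩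
    · rintro ⟨_, w, ⟨d, hd, u, v, hu, hv, rfl⟩, hw, rfl⟩
      exact ⟨d, hd, u, _, hu, ⟨v, w, hv, hw, rfl⟩, by simp only [mul_assoc]⟩

theorem IsWordValue.red_step
    (hP : ∀ a u, u * φ a * u = u → ∀ d ∈ P, u * d * φ a ∈ P ∧ φ a * d * u ∈ P)
    {L L' : List (A × Bool)} (h : FreeGroup.Red.Step L L') {m : M}
    (hm : IsWordValue φ P L m) : IsWordValue φ P L' m := by
  obtain @⟨L₁, L₂, a, b⟩ := h
  rw [isWordValue_append] at hm ⊢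
  obtain ⟨u, _, hu, ⟨d, hd, x, _, hx, ⟨e, he, y, v, hy, hv, rfl⟩, rfl⟩, rfl⟩ := hm
  refine ⟨u, d * (x * e * y) * v, hu, hv.mul_left (mul_mem hd ?_), by simp only [mul_assoc]⟩
  cases b with
  | true =>
    obtain rfl : x = φ a := hx
    exact (hP a y hy e he).2
  | false =>
    obtain rfl : y = φ a := hy
    exact (hP a x hx e he).1

variable (φ P) in
/-- `m` is a value of some signed word representing the free group element `g`. -/
def IsGroupValue (g : FreeGroup A) (m : M) : Prop :=
  ∃ L, FreeGroup.mk L = g ∧ IsWordValue φ P L m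

theorem IsGroupValue.mul {g h : FreeGroup A} {u v : M} (hu : IsGroupValue φ P g u)
    (hv : IsGroupValue φ P h v) : IsGroupValue φ P (g * h) (u * v) := by
  obtain ⟨L, rfl, hL⟩ := hu
  obtain ⟨L', rfl, hL'⟩ := hv
  exact ⟨L ++ L', FreeGroup.mul_mk.symm, (isWordValue_append _ _ _).2 ⟨u, v, hL, hL', rfl⟩⟩

theorem isGroupValue_one : IsGroupValue φ P 1 1 := ⟨[], rfl, one_mem P⟩

theorem isGroupValue_of (a : A) : IsGroupValue φ P (.of a) (φ a) :=
  ⟨[(a, true)], rfl, 1, one_mem P, φ a, 1, rfl, one_mem P, by simp⟩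

theorem isGroupValue_of_inv {a : A} {u : M} (hu : u * φ a * u = u) :
    IsGroupValue φ P (.of a)⁻¹ u :=
  ⟨[(a, false)], rfl, 1, one_mem P, u, 1, hu, one_mem P, by simp⟩

theorem IsGroupValue.mem
    (hP : ∀ a u, u * φ a * u = u → ∀ d ∈ P, u * d * φ a ∈ P ∧ φ a * d * u ∈ P)
    {m : M} (hm : IsGroupValue φ P 1 m) : m ∈ P := by
  obtain ⟨L, hL, hm⟩ := hm
  obtain ⟨L', h, h'⟩ := FreeGroup.Red.exact.1 (hL.trans FreeGroup.one_eq_mk)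
  obtain rfl := FreeGroup.Red.nil_iff.1 h'
  clear hL h'
  induction h using Relation.ReflTransGen.head_induction_on with
  | refl => exact hm
  | head h _ ih => exact ih (hm.red_step hP h)

end ExtendedWords

section CayleyGraph

variable {A M : Type} [Monoid M] (φ : A → M)

/-- The edges of the right Cayley graph of `M` that stay in a strongly connected component
(on the vertices `Sum.inl x`), together with an isolated edge for each letter. -/
def CayleyEdge : M ⊕ A × Bool → A → M ⊕ A × Bool → Prop
  | .inl x, a, .inl y => y = x * φ a ∧ ∃ m, y * m = x
  | .inr c, a, .inr d => c = (a, false) ∧ d = (a, true)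
  | _, _, _ => False

variable {φ} {P : Submonoid M}

theorem exists_pow_two_mul_add_one_eq [Finite M] (c : M) : ∃ t, c ^ (2 * t + 1) = c ^ t := by
  obtain ⟨i, j, hij, h⟩ : ∃ i j, i < j ∧ c ^ i = c ^ j := by
    obtain ⟨i, j, hne, h⟩ := Finite.exists_ne_map_eq_of_infinite fun n : ℕ => c ^ n
    obtain hlt | hlt := hne.lt_or_gt
    exacts [⟨i, j, hlt, h⟩, ⟨j, i, hlt, h.symm⟩]
  obtain ⟨p, rfl⟩ := Nat.exists_eq_add_of_lt hij
  have hper : ∀ k n, c ^ (i + n + k * (p + 1)) = c ^ (i + n) := by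
    intro k n
    induction k with
    | zero => simp
    | succ k ih =>
      rw [← ih]
      calc c ^ (i + n + (k + 1) * (p + 1)) = c ^ (i + p + 1) * c ^ (n + k * (p + 1)) := by
            rw [← pow_add]; congr 1; ring
        _ = _ := by rw [← h, ← pow_add]; congr 1; ring
  refine ⟨i + (i * p + p), ?_⟩
  rw [← hper (i + 1)]
  congr 1
  ring

theorem exists_weakInverse [Finite M] {x b m : M} (h : x * b * m = x) :
    ∃ u, u * b * u = u ∧ x * b * u = x := by
  obtain ⟨t, ht⟩ := exists_pow_two_mul_add_one_eq (b * m)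
  have hx : ∀ n, x * (b * m) ^ n = x := by
    intro n
    induction n with
    | zero => simp
    | succ n ih => rw [pow_succ, ← mul_assoc, ih, ← mul_assoc, h]
  refine ⟨m * (b * m) ^ t, ?_, ?_⟩
  · calc m * (b * m) ^ t * b * (m * (b * m) ^ t)
        = m * ((b * m) ^ t * (b * m) * (b * m) ^ t) := by simp only [mul_assoc]
      _ = m * (b * m) ^ t := by rw [← pow_succ, ← pow_add, ← ht]; congr 2; omega
  · rw [← mul_assoc, h, hx]

theorem WalkLabel.exists_isGroupValue [Finite M] {x : M} {g : FreeGroup A} {q : M ⊕ A × Bool}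
    (h : WalkLabel (CayleyEdge φ) (.inl x) g q) :
    ∃ y, q = .inl y ∧ ∃ m, IsGroupValue φ P g m ∧ x * m = y := by
  induction h with
  | refl => exact ⟨x, rfl, 1, isGroupValue_one, mul_one x⟩
  | @forward g q a r _ he ih =>
    obtain ⟨y, rfl, m, hm, rfl⟩ := ih
    match r, he with
    | .inl z, he =>
      exact ⟨z, rfl, m * φ a, hm.mul (isGroupValue_of a), by rw [he.1, mul_assoc]⟩
  | @backward g q a r _ he ih =>
    obtain ⟨y, rfl, m, hm, rfl⟩ := ih
    match q, he with
    | .inl z, he =>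
      obtain ⟨he, m', hm'⟩ := he
      rw [he] at hm'
      obtain ⟨u, hu, hzu⟩ := exists_weakInverse hm'
      exact ⟨z, rfl, m * u, hm.mul (isGroupValue_of_inv hu), by
        rw [← mul_assoc, he, hzu]⟩

theorem WalkLabel.eq_of_inr {a : A} {g : FreeGroup A} {q : M ⊕ A × Bool}
    (h : WalkLabel (CayleyEdge φ) (.inr (a, false)) g q) :
    q = .inr (a, false) ∧ g = 1 ∨ q = .inr (a, true) ∧ g = .of a := by
  induction h with
  | refl => exact .inl ⟨rfl, rfl⟩
  | @forward g q b r _ he ih =>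
    obtain ⟨rfl, rfl⟩ | ⟨rfl, rfl⟩ := ih
    · match r, he with
      | .inr r, he => simp_all [CayleyEdge]
    · match r, he with
      | .inr r, he => simp_all [CayleyEdge]
  | @backward g q b r _ he ih =>
    obtain ⟨rfl, rfl⟩ | ⟨rfl, rfl⟩ := ih
    · match q, he with
      | .inr r, he => simp_all [CayleyEdge]
    · match q, he with
      | .inr r, he => simp_all [CayleyEdge]

theorem exists_prodLabel_of_word [Finite M] (w : List A) (x : M) :
    ∃ (y : M) (l : List ((M ⊕ A × Bool) × (M ⊕ A × Bool))),
      l.length ≤ 2 * (Set.range (x * · : M → M)).ncard ∧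
      ProdLabel (CayleyEdge φ) ((.inl x, .inl y) :: l) (w.map FreeGroup.of).prod ∧
      ∀ γ, ProdLabel (CayleyEdge φ) ((.inl x, .inl y) :: l) γ →
        ∃ m, IsGroupValue φ P γ m ∧ x * m = x * (w.map φ).prod := by
  induction w generalizing x with
  | nil =>
    refine ⟨x, [], by simp, ⟨1, 1, .refl, rfl, by simp⟩, ?_⟩
    rintro _ ⟨g, _, hg, rfl, rfl⟩
    obtain ⟨y, hy, m, hm, h⟩ := hg.exists_isGroupValue (P := P)
    obtain rfl := Sum.inl_injective hy
    exact ⟨m, by simpa using hm, by simpa using h⟩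
  | cons a w ih =>
    obtain ⟨y, l, hl, ⟨g, r, hg, hr, hgr⟩, hval⟩ := ih (x * φ a)
    have hsub : Set.range (x * φ a * · : M → M) ⊆ Set.range (x * · : M → M) := by
      rintro _ ⟨m, rfl⟩
      exact ⟨φ a * m, (mul_assoc _ _ _).symm⟩
    have hval' : ∀ γ, ProdLabel (CayleyEdge φ) ((.inl (x * φ a), .inl y) :: l) γ →
        ∃ m, IsGroupValue φ P (.of a * γ) m ∧ x * m = x * ((a :: w).map φ).prod := by
      intro γ hγ
      obtain ⟨m, hm, hxm⟩ := hval γ hγ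
      exact ⟨φ a * m, (isGroupValue_of a).mul hm, by
        rw [List.map_cons, List.prod_cons, ← mul_assoc, hxm, mul_assoc]⟩
    by_cases hx : ∃ m, x * φ a * m = x
    · have he : CayleyEdge φ (.inl x) a (.inl (x * φ a)) := ⟨rfl, hx⟩
      refine ⟨y, l, hl.trans (Nat.mul_le_mul_left 2 (Set.ncard_le_ncard hsub)),
        ⟨_, r, (WalkLabel.edge he).trans hg, hr, by
          rw [List.map_cons, List.prod_cons, hgr, mul_assoc]⟩, ?_⟩
      rintro _ ⟨h, s, hh, hs, rfl⟩
      simpa [mul_assoc] using hval' _ ⟨_, s, (WalkLabel.edge_inv he).trans hh, hs, rfl⟩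
    · have hlt : (Set.range (x * φ a * · : M → M)).ncard <
          (Set.range (x * · : M → M)).ncard := by
        refine Set.ncard_lt_ncard ⟨hsub, fun h => hx (h ⟨1, mul_one x⟩)⟩
      refine ⟨x, (.inr (a, false), .inr (a, true)) :: (.inl (x * φ a), .inl y) :: l,
        by simp only [List.length_cons]; omega, ⟨1, _, .refl, ⟨.of a, _, WalkLabel.edge ⟨rfl, rfl⟩,
          ⟨g, r, hg, hr, rfl⟩, rfl⟩, by simp [hgr]⟩, ?_⟩
      rintro _ ⟨h, _, hh, ⟨k, s, hk, hs, rfl⟩, rfl⟩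
      obtain ⟨z, hz, m, hm, hxm⟩ := hh.exists_isGroupValue (P := P)
      obtain rfl := Sum.inl_injective hz
      obtain ⟨h', -⟩ | ⟨-, rfl⟩ := hk.eq_of_inr
      · simp at h'
      obtain ⟨m', hm', hxm'⟩ := hval' s hs
      exact ⟨m * m', hm.mul hm', by rw [← mul_assoc, hxm, hxm']⟩

end CayleyGraph

section DSub

variable {S : Type} [Semigroup S]

theorem idempotent_mem_DSub {e : S} (he : e * e = e) : e ∈ DSub S :=
  Subsemigroup.mem_sInf.2 fun _ hT => hT.1 e he

theorem weakConjClosed_DSub : WeakConjClosed (DSub S) := fun s t hst x hx =>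
  ⟨Subsemigroup.mem_sInf.2 fun T hT => (hT.2 s t hst x (Subsemigroup.mem_sInf.1 hx T hT)).1,
    Subsemigroup.mem_sInf.2 fun T hT => (hT.2 s t hst x (Subsemigroup.mem_sInf.1 hx T hT)).2⟩

variable (S) in
/-- `DSub S` with an identity adjoined. -/
def DSub.withOne : Submonoid (WithOne S) where
  carrier := {m | m = 1 ∨ ∃ s ∈ DSub S, m = s}
  one_mem' := .inl rfl
  mul_mem' := by
    rintro _ _ (rfl | ⟨s, hs, rfl⟩) (rfl | ⟨t, ht, rfl⟩)
    · exact .inl rfl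
    · exact .inr ⟨t, ht, one_mul _⟩
    · exact .inr ⟨s, hs, mul_one _⟩
    · exact .inr ⟨s * t, mul_mem hs ht, rfl⟩

theorem coe_mem_withOne_DSub {s : S} : (s : WithOne S) ∈ DSub.withOne S ↔ s ∈ DSub S := by
  constructor
  · rintro (h | ⟨t, ht, h⟩)
    · exact absurd h WithOne.coe_ne_one
    · rwa [WithOne.coe_inj.1 h]
  · exact fun h => .inr ⟨s, h, rfl⟩

theorem DSub.withOne_weakConj (a : S) (u : WithOne S) (hu : u * a * u = u) (d : WithOne S)
    (hd : d ∈ DSub.withOne S) :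
    u * d * a ∈ DSub.withOne S ∧ a * d * u ∈ DSub.withOne S := by
  cases u with
  | one => simp at hu
  | coe t =>
    have ht : t * a * t = t := by exact_mod_cast hu
    obtain rfl | ⟨d, hd, rfl⟩ := hd
    · simp only [mul_one, ← WithOne.coe_mul, coe_mem_withOne_DSub]
      exact ⟨idempotent_mem_DSub (by rw [← mul_assoc, ht]),
        idempotent_mem_DSub (by rw [mul_assoc, ← mul_assoc t, ht])⟩
    · simp only [← WithOne.coe_mul, coe_mem_withOne_DSub]
      exact weakConjClosed_DSub t a ht d hd

theorem IsTypeII.mem_DSub [Finite S] {s : S} (hs : IsTypeII s) : s ∈ DSub S := by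
  have : Finite (WithOne S) := inferInstanceAs (Finite (Option S))
  let φ : S → WithOne S := (↑)
  obtain ⟨G, _, _, π, hπ⟩ := exists_separates (CayleyEdge φ)
    (2 * (Set.range ((1 : WithOne S) * · : WithOne S → WithOne S)).ncard)
  let R : Subsemigroup (S × G) :=
    { carrier := {p | ∃ w : List S, (w.map φ).prod = p.1 ∧
        π (w.map FreeGroup.of).prod = p.2}
      mul_mem' := by
        rintro p q ⟨w, hw, hw'⟩ ⟨v, hv, hv'⟩
        exact ⟨w ++ v, by simp [hw, hv], by simp [hw', hv']⟩ }
  obtain ⟨w, hw, hw'⟩ := hs G R fun x => ⟨π (.of x), [x], by simp [φ], by simp⟩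
  obtain ⟨y, l, hl, hprod, hval⟩ :=
    exists_prodLabel_of_word (φ := φ) (P := DSub.withOne S) w 1
  obtain ⟨m, hm, h⟩ := hval 1 (hπ _ (by simpa using hl) _ hprod hw')
  rw [one_mul, one_mul, hw] at h
  subst h
  exact coe_mem_withOne_DSub.1 (hm.mem DSub.withOne_weakConj)

theorem pow_mem_prod {G : Type} [Group G] {R : Subsemigroup (S × G)} {e : S} {g : G}
    (he : e * e = e) (h : (e, g) ∈ R) (n : ℕ) : (e, g ^ (n + 1)) ∈ R := by
  induction n with
  | zero => simpa using h
  | succ n ih => simpa [he, pow_succ] using mul_mem ih h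

theorem exists_inv_mem {G : Type} [Group G] [Finite G] {R : Subsemigroup (S × G)} {s t : S}
    {g h : G} (hst : s * t * s = s) (hg : (s, g) ∈ R) (hh : (t, h) ∈ R) : (s, h⁻¹) ∈ R := by
  have key : ∀ n : ℕ, (s, (g * h) ^ n * g) ∈ R := by
    intro n
    induction n with
    | zero => simpa using hg
    | succ n ih =>
      have := mul_mem (mul_mem hg hh) ih
      simpa [hst, pow_succ', mul_assoc] using this
  have := key (orderOf (g * h) - 1)
  rwa [eq_mul_inv_of_mul_eq (pow_sub_one_mul (orderOf_pos (g * h)).ne' (g * h)),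
    pow_orderOf_eq_one, one_mul, mul_inv_rev, inv_mul_cancel_right] at this

theorem isTypeII_of_mem_DSub {s : S} (hs : s ∈ DSub S) : IsTypeII s := by
  intro G _ _ R hR
  let T : Subsemigroup S :=
    { carrier := {x | (x, (1 : G)) ∈ R}
      mul_mem' := fun {a b} ha hb => by simpa using mul_mem (S := Subsemigroup (S × G)) ha hb }
  refine Subsemigroup.mem_sInf.1 hs T ⟨fun e he => ?_, fun s t hst x hx => ?_⟩
  · obtain ⟨g, hg⟩ := hR e
    have := pow_mem_prod he hg (orderOf g - 1)
    rwa [Nat.sub_add_cancel (orderOf_pos g), pow_orderOf_eq_one] at this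
  · obtain ⟨g, hg⟩ := hR s
    obtain ⟨h, hh⟩ := hR t
    have hs := exists_inv_mem hst hg hh
    have hx : (x, (1 : G)) ∈ R := hx
    have h₁ := mul_mem (mul_mem hs hx) hh
    have h₂ := mul_mem (mul_mem hh hx) hs
    simp only [Prod.mk_mul_mk, mul_one, inv_mul_cancel, mul_inv_cancel] at h₁ h₂
    exact ⟨h₁, h₂⟩

end DSub

/-- Ash's theorem, the type II conjecture: for every finite semigroup `S`,
`K(S) = D(S)`: an element is of type II iff it lies in the smallest subsemigroup of `S`
containing all idempotents and closed under weak conjugation. -/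
theorem ash_type_II (S : Type) [Semigroup S] [Finite S] (s : S) :
    IsTypeII s ↔ s ∈ DSub S := by
  exact ⟨IsTypeII.mem_DSub, isTypeII_of_mem_DSub⟩
end

section
/- Let S be a finite semigroup. The set K(S) of type II elements is a subsemigroup of S that contains every idempotent of S and is closed under weak conjugation; consequently D(S) ⊆ K(S). -/
theorem IsTypeII.mul {S : Type} [Semigroup S] {a b : S} (ha : IsTypeII a) (hb : IsTypeII b) :
    IsTypeII (a * b) := by
  intro G _ _ R hR
  simpa using R.mul_mem (ha G R hR) (hb G R hR)

theorem isTypeII_of_mul_self {S : Type} [Semigroup S] {e : S} (he : e * e = e) :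
    IsTypeII e := by
  intro G _ _ R hR
  obtain ⟨g, hg⟩ := hR e
  have hpow : ∀ k : ℕ, (e, g ^ (k + 1)) ∈ R := by
    intro k
    induction k with
    | zero => simpa using hg
    | succ k ih => simpa [he, pow_succ] using R.mul_mem ih hg
  have h := hpow (orderOf g - 1)
  rwa [Nat.sub_add_cancel (orderOf_pos g), pow_orderOf_eq_one] at h

/-- A weak inverse pair can be related to mutually inverse elements of a finite group. -/
theorem mem_inv_of_mul_mul_self {S G : Type} [Semigroup S] [Group G] [Finite G]
    {R : Subsemigroup (S × G)} {s t : S} {g h : G} (hst : s * t * s = s)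
    (hs : (s, g) ∈ R) (ht : (t, h) ∈ R) : (s, h⁻¹) ∈ R := by
  have hpow : ∀ k : ℕ, (s, g * (h * g) ^ k) ∈ R := by
    intro k
    induction k with
    | zero => simpa using hs
    | succ k ih =>
      simpa [hst, pow_succ, mul_assoc] using R.mul_mem (R.mul_mem ih ht) hs
  have hinv : (h * g) ^ (orderOf (h * g) - 1) = (h * g)⁻¹ := by
    rw [eq_inv_iff_mul_eq_one, ← pow_succ, Nat.sub_add_cancel (orderOf_pos _),
      pow_orderOf_eq_one]
  simpa [hinv] using hpow (orderOf (h * g) - 1)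

theorem IsTypeII.weakConj {S : Type} [Semigroup S] {s t x : S} (hst : s * t * s = s)
    (hx : IsTypeII x) : IsTypeII (s * x * t) ∧ IsTypeII (t * x * s) := by
  constructor <;> intro G _ _ R hR <;> obtain ⟨g, hs⟩ := hR s <;> obtain ⟨h, ht⟩ := hR t <;>
    have hinv := mem_inv_of_mul_mul_self hst hs ht
  · simpa using R.mul_mem (R.mul_mem hinv (hx G R hR)) ht
  · simpa using R.mul_mem (R.mul_mem ht (hx G R hR)) hinv

/-- The group kernel `K(S)` as a subsemigroup. -/
def groupKernel (S : Type) [Semigroup S] : Subsemigroup S where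
  carrier := {s | IsTypeII s}
  mul_mem' := IsTypeII.mul

theorem DSub_le_groupKernel (S : Type) [Semigroup S] : DSub S ≤ groupKernel S :=
  sInf_le ⟨fun _ he => isTypeII_of_mul_self he, fun _ _ hst _ hx => IsTypeII.weakConj hst hx⟩

/-- for a finite semigroup `S`, the set `K(S)` of type II elements is a
subsemigroup containing every idempotent and closed under weak conjugation; consequently
`D(S) ⊆ K(S)`. -/
theorem type_II_subsemigroup_weakly_closed (S : Type) [Semigroup S] [Finite S] :
    (∀ a b : S, IsTypeII a → IsTypeII b → IsTypeII (a * b)) ∧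
    (∀ e : S, e * e = e → IsTypeII e) ∧
    (∀ s t : S, s * t * s = s →
      ∀ x : S, IsTypeII x → IsTypeII (s * x * t) ∧ IsTypeII (t * x * s)) ∧
    (∀ x ∈ DSub S, IsTypeII x) :=
  ⟨fun _ _ => IsTypeII.mul, fun _ => isTypeII_of_mul_self,
    fun _ _ hst _ => IsTypeII.weakConj hst, fun _ hx => DSub_le_groupKernel S hx⟩
end

section
/- (Kleene's theorem, syntactic form) Let A be a finite alphabet and L a language over A. Then L is a regular language if and only if the syntactic congruence ≈_L has only finitely many equivalence classes (equivalently, the syntactic monoid of L is finite). -/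
/-- The syntactic congruence of a language `L`: `x ≈_L y` iff for all words `u, v`,
`u ++ x ++ v ∈ L ↔ u ++ y ++ v ∈ L`. -/
def SynRel {A : Type} (L : Set (List A)) (x y : List A) : Prop :=
  ∀ u v : List A, (u ++ x ++ v ∈ L ↔ u ++ y ++ v ∈ L)

/-- The syntactic congruence as a setoid on words. -/
def synSetoid {A : Type} (L : Set (List A)) : Setoid (List A) where
  r := SynRel L
  iseqv := ⟨fun _ _ _ => Iff.rfl, fun h u v => (h u v).symm,
    fun h h' u v => (h u v).trans (h' u v)⟩

/-- Words inducing the same state transformation are syntactically congruent. -/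
theorem synRel_accepts_of_evalFrom_eq {A σ : Type} (M : DFA A σ) {x y : List A}
    (h : ∀ s, M.evalFrom s x = M.evalFrom s y) : SynRel M.accepts x y := by
  intro u v
  change M.evalFrom M.start (u ++ x ++ v) ∈ M.accept ↔
    M.evalFrom M.start (u ++ y ++ v) ∈ M.accept
  simp only [DFA.evalFrom_of_append, h]

theorem finite_quotient_synSetoid_accepts {A σ : Type} [Finite σ] (M : DFA A σ) :
    Finite (Quotient (synSetoid M.accepts)) := by
  refine Finite.of_injective
    (fun (q : Quotient (synSetoid M.accepts)) (s : σ) => M.evalFrom s q.out) fun p q h => ?_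
  rw [← p.out_eq, ← q.out_eq]
  exact Quotient.sound (synRel_accepts_of_evalFrom_eq M (congrFun h))

theorem SynRel.leftQuotient_eq {A : Type} {L : Language A} {x y : List A}
    (h : SynRel L x y) : L.leftQuotient x = L.leftQuotient y :=
  Set.ext fun v => h [] v

theorem finite_range_leftQuotient_of_finite_quotient {A : Type} (L : Language A)
    [Finite (Quotient (synSetoid L))] : (Set.range L.leftQuotient).Finite := by
  refine (Set.finite_range (Quotient.lift (s := synSetoid L) L.leftQuotient
    fun _ _ h => SynRel.leftQuotient_eq h)).subset ?_
  rintro _ ⟨x, rfl⟩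
  exact ⟨Quotient.mk _ x, rfl⟩

/-- Kleene's theorem, syntactic form: a language `L` over a finite alphabet is
regular (accepted by a deterministic finite automaton) iff its syntactic congruence has
finitely many classes, i.e. its syntactic monoid is finite. -/
theorem kleene_syntactic {A : Type} [Fintype A] (L : Set (List A)) :
    (∃ (σ : Type) (_ : Fintype σ) (M : DFA A σ), M.accepts = L) ↔
      Finite (Quotient (synSetoid L)) := by
  constructor
  · rintro ⟨σ, _, M, rfl⟩
    exact finite_quotient_synSetoid_accepts M
  · intro _
    exact Language.IsRegular.of_finite_range_leftQuotient
      (finite_range_leftQuotient_of_finite_quotient L)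
end

section
/- (Schützenberger's theorem) Let A be a finite alphabet and L a language over A. Then L is star-free if and only if the syntactic congruence ≈_L has finitely many equivalence classes and there exists n ≥ 1 such that for every word x, the n-fold concatenation xⁿ is ≈_L-equivalent to xⁿ⁺¹ (i.e., the syntactic monoid of L is finite and aperiodic). -/
/-- The star-free languages over `A`: the smallest class containing `∅`, `{ε}`, and `{a}` for
each letter `a`, closed under finite union, complement and concatenation. -/
inductive StarFree {A : Type} : Set (List A) → Prop
  | empty : StarFree (∅ : Set (List A))
  | epsilon : StarFree {([] : List A)}
  | letter (a : A) : StarFree {[a]}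
  | union {L₁ L₂ : Set (List A)} : StarFree L₁ → StarFree L₂ → StarFree (L₁ ∪ L₂)
  | compl {L : Set (List A)} : StarFree L → StarFree Lᶜ
  | concat {L₁ L₂ : Set (List A)} : StarFree L₁ → StarFree L₂ →
      StarFree {w | ∃ u ∈ L₁, ∃ v ∈ L₂, w = u ++ v}

/-- The `n`-fold concatenation `xⁿ` of a word `x`. -/
def wordPow {A : Type} (x : List A) (n : ℕ) : List A := (List.replicate n x).flatten

/-! ### Star-free languages -/

theorem StarFree.univ {A : Type} : StarFree (Set.univ : Set (List A)) := by
  simpa using (StarFree.empty (A := A)).compl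

theorem StarFree.inter {A : Type} {K L : Set (List A)} (hK : StarFree K) (hL : StarFree L) :
    StarFree (K ∩ L) := by
  simpa [Set.compl_union] using (hK.compl.union hL.compl).compl

theorem StarFree.iUnion {A ι : Type} [Finite ι] {K : ι → Set (List A)}
    (hK : ∀ i, StarFree (K i)) : StarFree (⋃ i, K i) := by
  have key : ∀ s : Set ι, s.Finite → StarFree (⋃ i ∈ s, K i) := by
    intro s hs
    induction s, hs using Set.Finite.induction_on with
    | empty => simpa using StarFree.empty
    | insert _ _ ih =>
      rw [Set.biUnion_insert]
      exact (hK _).union ih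
  simpa using key Set.univ Set.finite_univ

theorem StarFree.iUnion_initial {A M : Type} [Finite A] [Finite M] {φ : List A → M}
    {E : Set (M × A)} (hE : ∀ p ∈ E, StarFree (φ ⁻¹' {p.1})) :
    StarFree {w | ∃ r a t, (φ r, a) ∈ E ∧ w = r ++ a :: t} := by
  convert StarFree.iUnion fun p : E =>
    (hE p p.2).concat ((StarFree.letter p.1.2).concat StarFree.univ) using 1
  ext w
  simp only [Set.mem_iUnion, Set.mem_ofPred_eq]
  constructor
  · rintro ⟨r, a, t, h, rfl⟩
    exact ⟨⟨_, h⟩, r, rfl, a :: t, ⟨[a], rfl, t, trivial, rfl⟩, rfl⟩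
  · rintro ⟨⟨⟨m, a⟩, h⟩, r, rfl, _, ⟨_, rfl, t, -, rfl⟩, rfl⟩
    exact ⟨r, a, t, h, rfl⟩

theorem StarFree.iUnion_final {A M : Type} [Finite A] [Finite M] {φ : List A → M}
    {E : Set (A × M)} (hE : ∀ p ∈ E, StarFree (φ ⁻¹' {p.2})) :
    StarFree {w | ∃ t a r, (a, φ r) ∈ E ∧ w = t ++ a :: r} := by
  convert StarFree.iUnion fun p : E =>
    StarFree.univ.concat ((StarFree.letter p.1.1).concat (hE p p.2)) using 1
  ext w
  simp only [Set.mem_iUnion, Set.mem_ofPred_eq]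
  constructor
  · rintro ⟨t, a, r, h, rfl⟩
    exact ⟨⟨_, h⟩, t, trivial, a :: r, ⟨[a], rfl, r, rfl, rfl⟩, rfl⟩
  · rintro ⟨⟨⟨a, m⟩, h⟩, t, -, _, ⟨_, rfl, r, rfl, rfl⟩, rfl⟩
    exact ⟨t, a, r, h, rfl⟩

theorem StarFree.iUnion_letter {A : Type} [Finite A] (C : Set A) :
    StarFree {w | ∃ s a t, a ∈ C ∧ w = s ++ a :: t} := by
  convert StarFree.iUnion fun p : C =>
    StarFree.univ.concat ((StarFree.letter p.1).concat StarFree.univ) using 1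
  ext w
  simp only [Set.mem_iUnion, Set.mem_ofPred_eq]
  constructor
  · rintro ⟨s, a, t, h, rfl⟩
    exact ⟨⟨_, h⟩, s, trivial, a :: t, ⟨[a], rfl, t, trivial, rfl⟩, rfl⟩
  · rintro ⟨⟨a, h⟩, s, -, _, ⟨_, rfl, t, -, rfl⟩, rfl⟩
    exact ⟨s, a, t, h, rfl⟩

theorem StarFree.iUnion_factor {A M : Type} [Finite A] [Finite M] {φ : List A → M}
    {G : Set (A × M × A)} (hG : ∀ p ∈ G, StarFree (φ ⁻¹' {p.2.1})) :
    StarFree {w | ∃ s a g b t, (a, φ g, b) ∈ G ∧ w = s ++ a :: (g ++ b :: t)} := by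
  convert StarFree.iUnion fun p : G => StarFree.univ.concat ((StarFree.letter p.1.1).concat
    ((hG p p.2).concat ((StarFree.letter p.1.2.2).concat StarFree.univ))) using 1
  ext w
  simp only [Set.mem_iUnion, Set.mem_ofPred_eq]
  constructor
  · rintro ⟨s, a, g, b, t, h, rfl⟩
    exact ⟨⟨_, h⟩, s, trivial, _,
      ⟨[a], rfl, _, ⟨g, rfl, _, ⟨[b], rfl, t, trivial, rfl⟩, rfl⟩, rfl⟩, rfl⟩
  · rintro ⟨⟨⟨a, m, b⟩, h⟩, s, -, _, ⟨_, rfl, _, ⟨g, rfl, _, ⟨_, rfl, t, -, rfl⟩, rfl⟩, rfl⟩, rfl⟩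
    exact ⟨s, a, g, b, t, h, rfl⟩

/-! ### Finite aperiodic monoids -/

/-- The two-sided principal ideal generated by an element of a monoid. -/
def principalIdeal {M : Type} [Monoid M] (m : M) : Set M := {x | ∃ p q, x = p * m * q}

section Monoid

variable {M : Type} [Monoid M]

theorem mem_principalIdeal_self (m : M) : m ∈ principalIdeal m := ⟨1, 1, by simp⟩

theorem principalIdeal_subset {m n : M} (h : m ∈ principalIdeal n) :
    principalIdeal m ⊆ principalIdeal n := by
  obtain ⟨p, q, rfl⟩ := h
  rintro _ ⟨p', q', rfl⟩
  exact ⟨p' * p, q * q', by simp only [mul_assoc]⟩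

theorem principalIdeal_ssubset {m n : M} (h : m ∈ principalIdeal n)
    (h' : n ∉ principalIdeal m) : principalIdeal m ⊂ principalIdeal n :=
  ⟨principalIdeal_subset h, fun hs => h' (hs (mem_principalIdeal_self n))⟩

theorem eq_mul_of_eq_mul_mul {k : ℕ} (hk : ∀ x : M, x ^ k = x ^ (k + 1)) {m p q : M}
    (h : m = p * m * q) : m = p * m ∧ m = m * q := by
  have key : ∀ j : ℕ, m = p ^ j * m * q ^ j := by
    intro j
    induction j with
    | zero => simp
    | succ j ih =>
      calc m = p ^ j * (p * m * q) * q ^ j := by rw [← h]; exact ih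
        _ = p ^ (j + 1) * m * q ^ (j + 1) := by
          rw [pow_succ p, pow_succ' q]; simp only [mul_assoc]
  constructor
  · calc m = p ^ (k + 1) * m * q ^ k := by rw [← hk]; exact key k
      _ = p * (p ^ k * m * q ^ k) := by rw [pow_succ']; simp only [mul_assoc]
      _ = p * m := by rw [← key k]
  · calc m = p ^ k * m * q ^ (k + 1) := by rw [← hk]; exact key k
      _ = (p ^ k * m * q ^ k) * q := by rw [pow_succ]; simp only [mul_assoc]
      _ = m * q := by rw [← key k]

theorem eq_one_of_mul_eq_one_of_aperiodic {k : ℕ} (hk : ∀ x : M, x ^ k = x ^ (k + 1)) {p q : M}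
    (h : p * q = 1) : p = 1 ∧ q = 1 := by
  have := eq_mul_of_eq_mul_mul hk (m := 1) (p := p) (q := q) (by simpa using h.symm)
  simpa [eq_comm] using this

theorem eq_of_mem_principalIdeal {k : ℕ} (hk : ∀ x : M, x ^ k = x ^ (k + 1)) {m s a b : M}
    (ha : s = m * a) (hb : s = b * m) (h : m ∈ principalIdeal s) : s = m := by
  obtain ⟨c, d, h⟩ := h
  have h₁ : m = c * m := (eq_mul_of_eq_mul_mul hk (q := a * d) (by
    rw [ha] at h; simpa only [mul_assoc] using h)).1
  have h₂ : m = m * d := (eq_mul_of_eq_mul_mul hk (p := c * b) (by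
    rw [hb] at h; simpa only [mul_assoc] using h)).2
  have h₃ : s = s * d := by rw [hb, mul_assoc, ← h₂]
  calc s = m * a := ha
    _ = c * (m * a) := by rw [← mul_assoc, ← h₁]
    _ = c * s * d := by rw [← ha, mul_assoc, ← h₃]
    _ = m := h.symm

end Monoid

/-! ### Languages recognized by finite aperiodic monoids -/

section Recognition

variable {A M : Type} [Monoid M] {φ : List A → M}

theorem append_mem_principalIdeal (hφ : ∀ x y, φ (x ++ y) = φ x * φ y) (s x t : List A) :
    φ (s ++ x ++ t) ∈ principalIdeal (φ x) :=
  ⟨φ s, φ t, by rw [hφ, hφ]⟩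

theorem exists_left_crossing {P : List A → Prop} (h0 : ¬ P []) {w : List A} (hw : P w) :
    ∃ r a t, ¬ P r ∧ P (r ++ [a]) ∧ w = r ++ a :: t := by
  induction w using List.reverseRecOn with
  | nil => exact absurd hw h0
  | append_singleton w a ih =>
    by_cases h : P w
    · obtain ⟨r, b, t, h₁, h₂, rfl⟩ := ih h
      exact ⟨r, b, t ++ [a], h₁, h₂, by simp⟩
    · exact ⟨w, a, [], h, hw, rfl⟩

theorem exists_right_crossing {P : List A → Prop} (h0 : ¬ P []) {w : List A} (hw : P w) :
    ∃ t a r, ¬ P r ∧ P (a :: r) ∧ w = t ++ a :: r := by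
  induction w with
  | nil => exact absurd hw h0
  | cons a w ih =>
    by_cases h : P w
    · obtain ⟨t, b, r, h₁, h₂, rfl⟩ := ih h
      exact ⟨a :: t, b, r, h₁, h₂, rfl⟩
    · exact ⟨[], a, w, h, hw, rfl⟩

/-- A word with a property that fails for the empty word has a minimal factor with this property. -/
theorem exists_minimal_factor {P : List A → Prop} (h0 : ¬ P []) {w : List A} (hw : P w) :
    (∃ s a t, P [a] ∧ w = s ++ a :: t) ∨
      ∃ s a g b t, P (a :: (g ++ [b])) ∧ ¬ P (a :: g) ∧ ¬ P (g ++ [b]) ∧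
        w = s ++ a :: (g ++ b :: t) := by
  obtain ⟨r, b, t, h₁, h₂, rfl⟩ := exists_left_crossing
    (P := fun x => ∃ y z, x = y ++ z ∧ P z) (by simpa using h0) ⟨[], w, rfl, hw⟩
  obtain ⟨y, z, hyz, hz⟩ := h₂
  obtain ⟨s, a, g, h₃, h₄, rfl⟩ := exists_right_crossing h0 hz
  rcases List.eq_nil_or_concat g with rfl | ⟨g, c, rfl⟩
  · have : r = y ++ s ∧ b = a := by
      have : r ++ [b] = (y ++ s) ++ [a] := by simpa using hyz
      simpa using List.append_inj' this rfl
    obtain ⟨rfl, rfl⟩ := this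
    exact Or.inl ⟨y ++ s, b, t, h₄, rfl⟩
  · have : r = y ++ s ++ a :: g ∧ b = c := by
      have : r ++ [b] = (y ++ s ++ a :: g) ++ [c] := by simpa using hyz
      simpa using List.append_inj' this rfl
    obtain ⟨rfl, rfl⟩ := this
    exact Or.inr ⟨y ++ s, a, g, b, t, by simpa using h₄, fun h => h₁ ⟨_, _, rfl, h⟩,
      by simpa using h₃, by simp⟩

theorem preimage_one_eq {k : ℕ} (hk : ∀ x : M, x ^ k = x ^ (k + 1))
    (h1 : φ [] = 1) (hφ : ∀ x y, φ (x ++ y) = φ x * φ y) :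
    φ ⁻¹' {1} = {w | ∃ s a t, a ∈ {a | φ [a] ≠ 1} ∧ w = s ++ a :: t}ᶜ := by
  ext w
  simp only [Set.mem_preimage, Set.mem_singleton_iff, Set.mem_compl_iff, Set.mem_ofPred_eq]
  constructor
  · rintro h ⟨s, a, t, ha, rfl⟩
    rw [hφ, ← List.singleton_append, hφ] at h
    exact ha (eq_one_of_mul_eq_one_of_aperiodic hk
      (eq_one_of_mul_eq_one_of_aperiodic hk h).2).1
  · intro h
    by_contra hw
    obtain ⟨t, a, r, h₁, h₂, rfl⟩ := exists_right_crossing (P := fun x => φ x ≠ 1)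
      (by simpa using h1) hw
    refine h ⟨t, a, r, fun ha => h₂ ?_, rfl⟩
    rw [← List.singleton_append, hφ, ha, not_not.mp h₁, one_mul]

/-- The expression of the words of value `m ≠ 1` through words whose value generates a strictly
larger ideal. -/
theorem preimage_singleton_eq {k : ℕ} (hk : ∀ x : M, x ^ k = x ^ (k + 1))
    (h1 : φ [] = 1) (hφ : ∀ x y, φ (x ++ y) = φ x * φ y) {m : M} (hm : m ≠ 1) :
    φ ⁻¹' {m} =
      ({w | ∃ r a t, (φ r, a) ∈ {p : M × A | (∃ z, p.1 * φ [p.2] = m * z) ∧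
          (∃ z, m = p.1 * φ [p.2] * z) ∧ ¬ ∃ z, p.1 = m * z} ∧ w = r ++ a :: t} ∩
        {w | ∃ t a r, (a, φ r) ∈ {p : A × M | (∃ z, φ [p.1] * p.2 = z * m) ∧
          (∃ z, m = z * (φ [p.1] * p.2)) ∧ ¬ ∃ z, p.2 = z * m} ∧ w = t ++ a :: r}) ∩
      ({w | ∃ s a t, a ∈ {a | m ∉ principalIdeal (φ [a])} ∧ w = s ++ a :: t} ∪
        {w | ∃ s a g b t, (a, φ g, b) ∈ {p : A × M × A |
          m ∈ principalIdeal (φ [p.1] * p.2.1) ∧ m ∈ principalIdeal (p.2.1 * φ [p.2.2]) ∧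
          m ∉ principalIdeal (φ [p.1] * p.2.1 * φ [p.2.2])} ∧
          w = s ++ a :: (g ++ b :: t)})ᶜ := by
  have hcons : ∀ a x, φ (a :: x) = φ [a] * φ x := fun a x => by
    rw [← List.singleton_append, hφ]
  ext w
  simp only [Set.mem_preimage, Set.mem_singleton_iff, Set.mem_inter_iff, Set.mem_compl_iff,
    Set.mem_union, Set.mem_ofPred_eq]
  constructor
  · rintro rfl
    refine ⟨⟨?_, ?_⟩, ?_⟩
    · obtain ⟨r, a, t, h₁, h₂, rfl⟩ := exists_left_crossing
        (P := fun x => ∃ z, φ x = φ w * z) (w := w)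
        (fun ⟨z, hz⟩ => hm (eq_one_of_mul_eq_one_of_aperiodic hk (hz.symm.trans h1)).1)
        ⟨1, by simp⟩
      refine ⟨r, a, t, ⟨by rwa [← hφ], ⟨φ t, ?_⟩, h₁⟩, rfl⟩
      rw [hφ, hcons, mul_assoc]
    · obtain ⟨t, a, r, h₁, h₂, rfl⟩ := exists_right_crossing
        (P := fun x => ∃ z, φ x = z * φ w) (w := w)
        (fun ⟨z, hz⟩ => hm (eq_one_of_mul_eq_one_of_aperiodic hk (hz.symm.trans h1)).2)
        ⟨1, by simp⟩
      refine ⟨t, a, r, ⟨by rwa [← hcons], ⟨φ t, ?_⟩, h₁⟩, rfl⟩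
      rw [hφ, hcons]
    · rintro (⟨s, a, t, ha, rfl⟩ | ⟨s, a, g, b, t, ⟨-, -, h⟩, rfl⟩)
      · exact ha (by simpa using append_mem_principalIdeal hφ s [a] t)
      · refine h ?_
        rw [← hcons, ← hφ]
        simpa using append_mem_principalIdeal hφ s (a :: (g ++ [b])) t
  · rintro ⟨⟨⟨r, a, t, ⟨⟨z, hz⟩, -, -⟩, hl⟩, ⟨t', a', r', ⟨⟨z', hz'⟩, -, -⟩, hr⟩⟩, hw⟩
    by_contra hne
    have hJ : m ∉ principalIdeal (φ w) := by
      refine fun h => hne (eq_of_mem_principalIdeal hk (a := z * φ t) (b := φ t' * z') ?_ ?_ h)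
      · rw [hl, hφ, hcons, ← mul_assoc, hz, mul_assoc]
      · rw [hr, hφ, hcons, hz', mul_assoc]
    refine hw ?_
    rcases exists_minimal_factor (P := fun x => m ∉ principalIdeal (φ x))
      (not_not.mpr (h1 ▸ ⟨m, 1, by simp⟩)) hJ with
      h | ⟨s, a, g, b, t, h₁, h₂, h₃, h₄⟩
    · exact Or.inl h
    · refine Or.inr ⟨s, a, g, b, t, ⟨?_, ?_, ?_⟩, h₄⟩
      · rw [← hcons]; exact not_not.mp h₂
      · rw [← hφ]; exact not_not.mp h₃
      · rw [← hcons, ← hφ]; exact h₁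

theorem starFree_preimage_singleton [Finite A] [Finite M] {k : ℕ}
    (hk : ∀ x : M, x ^ k = x ^ (k + 1)) (h1 : φ [] = 1)
    (hφ : ∀ x y, φ (x ++ y) = φ x * φ y) (m : M) : StarFree (φ ⁻¹' {m}) := by
  induction m using (InvImage.wf principalIdeal
    (wellFounded_gt : WellFounded ((· > ·) : Set M → Set M → Prop))).induction with
  | _ m ih =>
  have ih' : ∀ n, m ∈ principalIdeal n → n ∉ principalIdeal m → StarFree (φ ⁻¹' {n}) :=
    fun n h h' => ih n (principalIdeal_ssubset h h')
  by_cases hm : m = 1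
  · rw [hm, preimage_one_eq hk h1 hφ]
    exact (StarFree.iUnion_letter _).compl
  rw [preimage_singleton_eq hk h1 hφ hm]
  refine ((StarFree.iUnion_initial ?_).inter (StarFree.iUnion_final ?_)).inter
    ((StarFree.iUnion_letter _).union (StarFree.iUnion_factor ?_)).compl
  · rintro ⟨n, a⟩ ⟨-, ⟨z, hz⟩, hn⟩
    refine ih' n ⟨1, φ [a] * z, by rw [hz]; simp only [mul_assoc, one_mul]⟩ ?_
    rintro ⟨x, y, rfl⟩
    refine hn ⟨y, ?_⟩
    have := (eq_mul_of_eq_mul_mul hk (m := m) (p := x) (q := y * φ [a] * z)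
      (by simpa only [mul_assoc] using hz)).1
    simp only [← this]
  · rintro ⟨a, n⟩ ⟨-, ⟨z, hz⟩, hn⟩
    refine ih' n ⟨z * φ [a], 1, by rw [hz]; simp only [mul_assoc, mul_one]⟩ ?_
    rintro ⟨x, y, rfl⟩
    refine hn ⟨x, ?_⟩
    have := (eq_mul_of_eq_mul_mul hk (m := m) (p := z * φ [a] * x) (q := y)
      (by simpa only [mul_assoc] using hz)).2
    simp only [mul_assoc, ← this]
  · rintro ⟨a, n, b⟩ ⟨⟨s, t, hl⟩, ⟨s', t', hr⟩, hn⟩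
    refine ih' n ⟨s * φ [a], t, by rw [hl]; simp only [mul_assoc]⟩ ?_
    rintro ⟨x, y, hxy⟩
    have e₁ : n = x * s * φ [a] * n := (eq_mul_of_eq_mul_mul hk (q := t * y) (by
      rw [hl] at hxy; simpa only [mul_assoc] using hxy)).1
    have e₂ : n = n * (φ [b] * t' * y) := (eq_mul_of_eq_mul_mul hk (p := x * s') (by
      rw [hr] at hxy; simpa only [mul_assoc] using hxy)).2
    refine hn (principalIdeal_subset (m := n) ⟨x * s, t' * y, ?_⟩
      ⟨s * φ [a], t, by rw [hl]; simp only [mul_assoc]⟩)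
    calc n = x * s * φ [a] * (n * (φ [b] * t' * y)) := by rw [← e₂]; exact e₁
      _ = _ := by simp only [mul_assoc]

end Recognition

/-! ### The syntactic congruence -/

theorem SynRel.append {A : Type} {L : Set (List A)} {x x' y y' : List A} (h : SynRel L x x')
    (h' : SynRel L y y') : SynRel L (x ++ y) (x' ++ y') := fun u v => by
  have h₁ := h u (y ++ v)
  have h₂ := h' (u ++ x') v
  simp only [List.append_assoc] at h₁ h₂ ⊢
  exact h₁.trans h₂

theorem SynRel.refl {A : Type} (L : Set (List A)) (x : List A) : SynRel L x x :=
  fun _ _ => Iff.rfl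

theorem wordPow_add {A : Type} (x : List A) (m n : ℕ) :
    wordPow x (m + n) = wordPow x m ++ wordPow x n := by
  simp only [wordPow, List.replicate_add, List.flatten_append]

theorem wordPow_succ {A : Type} (x : List A) (n : ℕ) :
    wordPow x (n + 1) = x ++ wordPow x n := by
  simp [wordPow, List.replicate_succ]

/-- The syntactic congruence as a congruence on the free monoid. -/
def synCon {A : Type} (L : Set (List A)) : Con (FreeMonoid A) where
  toSetoid := synSetoid L
  mul' := fun h h' => SynRel.append h h'

theorem starFree_of_finite_of_aperiodic {A : Type} [Finite A] {L : Set (List A)}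
    (hfin : Finite (Quotient (synSetoid L))) {n : ℕ}
    (hn : ∀ x : List A, SynRel L (wordPow x n) (wordPow x (n + 1))) : StarFree L := by
  let φ : List A → (synCon L).Quotient := fun w => Quotient.mk (synSetoid L) w
  have hφ : ∀ x y, φ (x ++ y) = φ x * φ y := fun _ _ => rfl
  have : Finite (synCon L).Quotient := hfin
  have hpow : ∀ x j, φ (wordPow x j) = φ x ^ j := by
    intro x j
    induction j with
    | zero => rfl
    | succ j ih => rw [wordPow_succ, hφ, ih, pow_succ']
  have hk : ∀ x : (synCon L).Quotient, x ^ n = x ^ (n + 1) := by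
    intro x
    obtain ⟨x, rfl⟩ : ∃ w, φ w = x := Quotient.exists_rep x
    rw [← hpow, ← hpow]
    exact Quotient.sound (hn x)
  have hL : L = ⋃ m : φ '' L, φ ⁻¹' {m.1} := by
    ext w
    simp only [Set.mem_iUnion]
    constructor
    · exact fun hw => ⟨⟨φ w, w, hw, rfl⟩, rfl⟩
    · rintro ⟨⟨_, w', hw', rfl⟩, h⟩
      have := (Quotient.exact h : SynRel L w w') [] []
      simp only [List.nil_append, List.append_nil] at this
      exact this.2 hw'
  rw [hL]
  exact StarFree.iUnion fun m => starFree_preimage_singleton hk rfl hφ m.1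

/-! ### Star-free languages have a finite aperiodic syntactic monoid -/

theorem finite_quotient_of_map {A β : Type} [Finite β] {L : Set (List A)} (f : List A → β)
    (hf : ∀ x y, f x = f y → SynRel L x y) : Finite (Quotient (synSetoid L)) := by
  refine Finite.of_injective (fun q : Quotient (synSetoid L) => f q.out) fun q q' h => ?_
  rw [← q.out_eq, ← q'.out_eq]
  exact Quotient.sound (hf _ _ h)

theorem SynRel.wordPow_of_le {A : Type} {L : Set (List A)} {x : List A} {n m : ℕ}
    (h : SynRel L (wordPow x n) (wordPow x (n + 1))) (hm : n ≤ m) :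
    SynRel L (wordPow x m) (wordPow x (m + 1)) := by
  obtain ⟨j, rfl⟩ := Nat.exists_eq_add_of_le hm
  rw [show n + j + 1 = (n + 1) + j by omega, wordPow_add, wordPow_add]
  exact h.append (SynRel.refl L _)

theorem exists_split_of_wordPow_eq_append {A : Type} {x p s : List A} {n : ℕ}
    (h : wordPow x (n + 1) = p ++ s) : ∃ i j p' s', i + j = n ∧ x = p' ++ s' ∧
      p = wordPow x i ++ p' ∧ s = s' ++ wordPow x j := by
  induction n generalizing p with
  | zero =>
    refine ⟨0, 0, p, s, rfl, ?_, ?_, ?_⟩ <;> simp_all [wordPow]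
  | succ n ih =>
    rw [wordPow_succ] at h
    rcases List.append_eq_append_iff.mp h with ⟨c, rfl, hc⟩ | ⟨c, hx, rfl⟩
    · obtain ⟨i, j, p', s', hij, hx, rfl, rfl⟩ := ih hc
      exact ⟨i + 1, j, p', s', by omega, hx, by rw [wordPow_succ, List.append_assoc], rfl⟩
    · exact ⟨0, n + 1, p, c, by omega, hx, by simp [wordPow], rfl⟩

/-- Membership of `u ++ x ++ v` in a concatenation, according to the place of the cut. -/
theorem append_append_mem_concat_iff {A : Type} {K L : Set (List A)} {u x v : List A} :
    u ++ x ++ v ∈ {w | ∃ a ∈ K, ∃ b ∈ L, w = a ++ b} ↔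
      (∃ p s, u = p ++ s ∧ p ∈ K ∧ s ++ x ++ v ∈ L) ∨
      (∃ p s, x = p ++ s ∧ u ++ p ∈ K ∧ s ++ v ∈ L) ∨
      (∃ p s, v = p ++ s ∧ u ++ x ++ p ∈ K ∧ s ∈ L) := by
  constructor
  · rintro ⟨a, ha, b, hb, h⟩
    rw [List.append_assoc] at h
    rcases List.append_eq_append_iff.mp h with ⟨c, rfl, hc⟩ | ⟨c, rfl, rfl⟩
    · rcases List.append_eq_append_iff.mp hc with ⟨d, rfl, rfl⟩ | ⟨d, rfl, rfl⟩
      · exact Or.inr (Or.inr ⟨d, b, rfl, by simpa using ha, hb⟩)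
      · exact Or.inr (Or.inl ⟨c, d, rfl, ha, hb⟩)
    · exact Or.inl ⟨a, c, rfl, ha, by simpa using hb⟩
  · rintro (⟨p, s, rfl, hp, hs⟩ | ⟨p, s, rfl, hp, hs⟩ | ⟨p, s, rfl, hp, hs⟩)
    · exact ⟨p, hp, _, hs, by simp⟩
    · exact ⟨_, hp, _, hs, by simp⟩
    · exact ⟨_, hp, _, hs, by simp⟩

theorem synRel_concat {A : Type} {K L : Set (List A)} {x y : List A} (hK : SynRel K x y)
    (hL : SynRel L x y)
    (hxy : ∀ p s, x = p ++ s → ∃ p' s', y = p' ++ s' ∧ SynRel K p p' ∧ SynRel L s s')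
    (hyx : ∀ p s, y = p ++ s → ∃ p' s', x = p' ++ s' ∧ SynRel K p p' ∧ SynRel L s s') :
    SynRel {w | ∃ a ∈ K, ∃ b ∈ L, w = a ++ b} x y := by
  have cut : ∀ {x y : List A},
      (∀ p s, x = p ++ s → ∃ p' s', y = p' ++ s' ∧ SynRel K p p' ∧ SynRel L s s') →
      ∀ u v, (∃ p s, x = p ++ s ∧ u ++ p ∈ K ∧ s ++ v ∈ L) →
        ∃ p s, y = p ++ s ∧ u ++ p ∈ K ∧ s ++ v ∈ L := by
    rintro x y h u v ⟨p, s, hx, hp, hs⟩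
    obtain ⟨p', s', hy, hpp, hss⟩ := h p s hx
    exact ⟨p', s', hy, by simpa using (hpp u []).1 (by simpa using hp), (hss [] v).1 hs⟩
  intro u v
  rw [append_append_mem_concat_iff, append_append_mem_concat_iff]
  exact or_congr (exists₂_congr fun p s => and_congr_right' (and_congr_right' (hL s v)))
    (or_congr ⟨cut hxy u v, cut hyx u v⟩
      (exists₂_congr fun p s => and_congr_right' (and_congr_left' (hK u p))))

theorem finite_quotient_concat {A : Type} {K L : Set (List A)}
    (hK : Finite (Quotient (synSetoid K))) (hL : Finite (Quotient (synSetoid L))) :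
    Finite (Quotient (synSetoid {w | ∃ a ∈ K, ∃ b ∈ L, w = a ++ b})) := by
  let k : List A → Quotient (synSetoid K) := Quotient.mk _
  let l : List A → Quotient (synSetoid L) := Quotient.mk _
  let S : List A → Set (Quotient (synSetoid K) × Quotient (synSetoid L)) :=
    fun x => {q | ∃ p s, x = p ++ s ∧ (k p, l s) = q}
  have cut : ∀ x y, S x = S y → ∀ p s, x = p ++ s →
      ∃ p' s', y = p' ++ s' ∧ SynRel K p p' ∧ SynRel L s s' := by
    intro x y h p s hx
    obtain ⟨p', s', hy, e⟩ : (k p, l s) ∈ S y := h ▸ ⟨p, s, hx, rfl⟩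
    exact ⟨p', s', hy, Quotient.exact (Prod.ext_iff.mp e).1.symm,
      Quotient.exact (Prod.ext_iff.mp e).2.symm⟩
  refine finite_quotient_of_map (fun x => (k x, l x, S x)) fun x y h => ?_
  simp only [Prod.mk.injEq] at h
  exact synRel_concat (Quotient.exact h.1) (Quotient.exact h.2.1) (cut x y h.2.2)
    (cut y x h.2.2.symm)

theorem synRel_wordPow_concat {A : Type} {K L : Set (List A)} {x : List A} {n : ℕ}
    (hK : SynRel K (wordPow x n) (wordPow x (n + 1)))
    (hL : SynRel L (wordPow x n) (wordPow x (n + 1))) :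
    SynRel {w | ∃ a ∈ K, ∃ b ∈ L, w = a ++ b}
      (wordPow x (2 * n + 1)) (wordPow x (2 * n + 1 + 1)) := by
  have join : ∀ {i j N : ℕ} {p s : List A}, i + j + 1 = N → x = p ++ s →
      wordPow x N = (wordPow x i ++ p) ++ (s ++ wordPow x j) := by
    rintro i j N p s rfl hx
    rw [add_assoc, wordPow_add, wordPow_succ]
    nth_rewrite 2 [hx]
    simp
  refine synRel_concat (hK.wordPow_of_le (by omega)) (hL.wordPow_of_le (by omega)) ?_ ?_
  · intro p s h
    obtain ⟨i, j, p', s', hij, hx, rfl, rfl⟩ := exists_split_of_wordPow_eq_append h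
    rcases le_total n i with hi | hi
    · exact ⟨_, _, join (i := i + 1) (by omega) hx,
        (hK.wordPow_of_le hi).append (SynRel.refl K p'), SynRel.refl L _⟩
    · exact ⟨_, _, join (j := j + 1) (by omega) hx, SynRel.refl K _,
        (SynRel.refl L s').append (hL.wordPow_of_le (by omega))⟩
  · intro p s h
    obtain ⟨i, j, p', s', hij, hx, rfl, rfl⟩ := exists_split_of_wordPow_eq_append h
    rcases lt_or_ge n i with hi | hi
    · obtain ⟨i, rfl⟩ : ∃ i', i = i' + 1 := ⟨i - 1, by omega⟩
      exact ⟨_, _, join (i := i) (by omega) hx, SynRel.append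
        (fun u v => (hK.wordPow_of_le (by omega) u v).symm) (SynRel.refl K p'), SynRel.refl L _⟩
    · obtain ⟨j, rfl⟩ : ∃ j', j = j' + 1 := ⟨j - 1, by omega⟩
      exact ⟨_, _, join (j := j) (by omega) hx, SynRel.refl K _,
        (SynRel.refl L s').append (fun u v => (hL.wordPow_of_le (by omega) u v).symm)⟩

theorem SynRel.union {A : Type} {K L : Set (List A)} {x y : List A} (hK : SynRel K x y)
    (hL : SynRel L x y) : SynRel (K ∪ L) x y :=
  fun u v => or_congr (hK u v) (hL u v)

theorem SynRel.compl {A : Type} {L : Set (List A)} {x y : List A} (h : SynRel L x y) :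
    SynRel Lᶜ x y :=
  fun u v => not_congr (h u v)

theorem synRel_singleton_nil {A : Type} {x y : List A} (h : x = [] ↔ y = []) :
    SynRel {([] : List A)} x y := fun u v => by
  simp [h]

theorem synRel_singleton_letter {A : Type} {a : A} {x y : List A} (h : x = [] ↔ y = [])
    (h' : x = [a] ↔ y = [a]) : SynRel {[a]} x y := fun u v => by
  simp only [Set.mem_singleton_iff, List.append_eq_singleton_iff, List.append_eq_nil_iff, h, h']

theorem finite_and_aperiodic_of_starFree {A : Type} {L : Set (List A)} (hL : StarFree L) :
    Finite (Quotient (synSetoid L)) ∧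
      ∃ n : ℕ, 1 ≤ n ∧ ∀ x : List A, SynRel L (wordPow x n) (wordPow x (n + 1)) := by
  induction hL with
  | empty =>
    exact ⟨finite_quotient_of_map (fun _ => ()) fun _ _ _ _ _ => Iff.rfl,
      1, le_rfl, fun _ _ _ => Iff.rfl⟩
  | epsilon =>
    refine ⟨finite_quotient_of_map (fun x => x = []) fun x y h => synRel_singleton_nil h.to_iff,
      1, le_rfl, fun x => synRel_singleton_nil ?_⟩
    simp [wordPow]
  | letter a =>
    refine ⟨finite_quotient_of_map (fun x => (x = [], x = [a])) fun x y h => ?_,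
      2, by omega, fun x => synRel_singleton_letter ?_ ?_⟩
    · simp only [Prod.mk.injEq] at h
      exact synRel_singleton_letter h.1.to_iff h.2.to_iff
    · simp [wordPow]
    · rcases x with _ | ⟨b, x⟩ <;> simp [wordPow, List.replicate_succ]
  | @union K L _ _ ihK ihL =>
    obtain ⟨hK, m, hm, hmK⟩ := ihK
    obtain ⟨hL, n, hn, hnL⟩ := ihL
    refine ⟨finite_quotient_of_map
      (fun x => (Quotient.mk (synSetoid K) x, Quotient.mk (synSetoid L) x)) fun x y h => ?_,
      max m n, by omega, fun x => ?_⟩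
    · simp only [Prod.mk.injEq] at h
      exact SynRel.union (Quotient.exact h.1) (Quotient.exact h.2)
    · exact ((hmK x).wordPow_of_le (le_max_left _ _)).union
        ((hnL x).wordPow_of_le (le_max_right _ _))
  | @compl L _ ih =>
    obtain ⟨hL, n, hn, h⟩ := ih
    exact ⟨finite_quotient_of_map (Quotient.mk (synSetoid L)) fun x y h =>
      SynRel.compl (Quotient.exact h), n, hn, fun x => (h x).compl⟩
  | concat _ _ ihK ihL =>
    obtain ⟨hK, m, hm, hmK⟩ := ihK
    obtain ⟨hL, n, hn, hnL⟩ := ihL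
    exact ⟨finite_quotient_concat hK hL, 2 * max m n + 1, by omega, fun x =>
      synRel_wordPow_concat ((hmK x).wordPow_of_le (le_max_left _ _))
        ((hnL x).wordPow_of_le (le_max_right _ _))⟩

/-- Schützenberger's theorem: a language `L` over a finite alphabet is
star-free iff its syntactic congruence has finitely many classes and there is `n ≥ 1` with
`xⁿ ≈_L xⁿ⁺¹` for every word `x` (the syntactic monoid is finite and aperiodic). -/
theorem schutzenberger_star_free {A : Type} [Fintype A] (L : Set (List A)) :
    StarFree L ↔
      Finite (Quotient (synSetoid L)) ∧
      ∃ n : ℕ, 1 ≤ n ∧ ∀ x : List A, SynRel L (wordPow x n) (wordPow x (n + 1)) := by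
  exact ⟨finite_and_aperiodic_of_starFree, fun ⟨hfin, _, _, hn⟩ =>
    starFree_of_finite_of_aperiodic hfin hn⟩
end
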